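/- arXiv:2312.06650 — 2 statements merged into one kernel-verified Lean document; each statement's English description precedes it below -/
import Mathlib

section
/- Let d, D ≥ 1 be integers, s ∈ ℕ, and δ > 0. There exists a threshold p_0 depending only on δ, d and D such that for every prime p ≥ p_0 the following holds. Let P = {ℓ_1v_1 + ⋯ + ℓ_Dv_D : ℓ_i ∈ ℤ, −L_i < ℓ_i < L_i} ⊆ 𝔽_p^d be a proper homogeneous generalized arithmetic progression of rank D with |P| > δ·p^d, let M : 𝔽_p^d → 𝔽_p be a non-degenerate quadratic form, and let F : P → HP_d(s) be a map such that F(x) + F(y) − F(x+y) ∈ J^M_x ∩ J^M_y for all linearly independent x, y ∈ P(1/2). If d ≥ s + 9, then there exist a super polynomial G : HP_d(1) → HP_d(s−2) and a locally linear map T : P(1/32) → HP_d(s) such that F(x) − L_x^2·G(L_x) − T(x) ∈ J^M for all x ∈ P(1/32) with x ≠ 0. -/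
noncomputable section

open MvPolynomial

/-- The quadratic polynomial `n ↦ (nA)·n`. -/
def quadPoly (p d : ℕ) (A : Matrix (Fin d) (Fin d) (ZMod p)) :
    MvPolynomial (Fin d) (ZMod p) :=
  ∑ i : Fin d, ∑ j : Fin d, MvPolynomial.C (A i j) * (MvPolynomial.X i * MvPolynomial.X j)

/-- The linear polynomial `n ↦ (hA)·n`. -/
def linPoly (p d : ℕ) (A : Matrix (Fin d) (Fin d) (ZMod p)) (h : Fin d → ZMod p) :
    MvPolynomial (Fin d) (ZMod p) :=
  ∑ j : Fin d, MvPolynomial.C (∑ i : Fin d, h i * A i j) * MvPolynomial.X j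

/-- The ideal `J^M_V` attached to the quadratic form with associated matrix `A` and the
set of vectors `V`: it is generated by `n ↦ (nA)·n` and `n ↦ (hA)·n` for `h ∈ V`. -/
def JM (p d : ℕ) (A : Matrix (Fin d) (Fin d) (ZMod p)) (V : Set (Fin d → ZMod p)) :
    Ideal (MvPolynomial (Fin d) (ZMod p)) :=
  Ideal.span ({quadPoly p d A} ∪ (linPoly p d A '' V))

/-- `M` is the quadratic form `n ↦ (nA)·n + n·u + v` with `A` symmetric. -/
def IsQuadFormWith (p d : ℕ) (M : (Fin d → ZMod p) → ZMod p)
    (A : Matrix (Fin d) (Fin d) (ZMod p)) (u : Fin d → ZMod p) (v : ZMod p) : Prop :=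
  A.IsSymm ∧ ∀ n : Fin d → ZMod p,
    M n = (∑ j : Fin d, (∑ i : Fin d, n i * A i j) * n j) + (∑ i : Fin d, n i * u i) + v

/-- The linear polynomial `L_x : n ↦ (nA)·x`. -/
def lx (p d : ℕ) (A : Matrix (Fin d) (Fin d) (ZMod p)) (x : Fin d → ZMod p) :
    MvPolynomial (Fin d) (ZMod p) :=
  ∑ i : Fin d, MvPolynomial.C (∑ j : Fin d, A i j * x j) * MvPolynomial.X i

/-- The (rescaled by `c`) generalized arithmetic progression with generators `v` and
lengths `L`: all sums `ℓ₁v₁ + ⋯ + ℓ_Dv_D` with `ℓ_i ∈ ℤ`, `|ℓ_i| < c·L_i`. -/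
def gap (p d D : ℕ) (v : Fin D → Fin d → ZMod p) (L : Fin D → ℝ) (c : ℝ) :
    Set (Fin d → ZMod p) :=
  {x | ∃ ℓ : Fin D → ℤ, (∀ i, -(c * L i) < (ℓ i : ℝ) ∧ (ℓ i : ℝ) < c * L i) ∧
    x = ∑ i, ℓ i • v i}

/-- The generalized arithmetic progression with generators `v` and lengths `L` is proper:
distinct admissible integer tuples give distinct elements. -/
def gapProper (p d D : ℕ) (v : Fin D → Fin d → ZMod p) (L : Fin D → ℝ) : Prop :=
  ∀ ℓ ℓ' : Fin D → ℤ, (∀ i, -(L i) < (ℓ i : ℝ) ∧ (ℓ i : ℝ) < L i) →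
    (∀ i, -(L i) < (ℓ' i : ℝ) ∧ (ℓ' i : ℝ) < L i) →
    (∑ i, ℓ i • v i) = (∑ i, ℓ' i • v i) → ℓ = ℓ'

namespace Polynomial.S14

def Gd {K V : Type*} [Field K] [AddCommGroup V] [Module K V] (k : ℕ) (B : List V) (a : V) : Prop :=
  ∀ T : Finset V, (∀ t ∈ T, t ∈ B) → T.card ≤ k → a ∉ Submodule.span K (T : Set V)

def GdL {K V : Type*} [Field K] [AddCommGroup V] [Module K V] (Q : Set V) (k : ℕ) :
    List V → List V → Prop
  | _, [] => True
  | B, (a :: l) => a ∈ Q ∧ Gd (K := K) k B a ∧ GdL (K := K) Q k (a :: B) l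

structure Ax {K V R : Type*} [Field K] [AddCommGroup V] [Module K V] [CommRing R] [Algebra K R]
    (lam : V →ₗ[K] R) (Rt : ℤ → Submodule K R) : Prop where
  mul : ∀ x f t, f ∈ Rt t → lam x * f ∈ Rt (t + 1)
  neg : ∀ t f, t < 0 → f ∈ Rt t → f = 0
  reg : ∀ x f, x ≠ 0 → lam x * f = 0 → f = 0
  reg2 : ∀ x y f, LinearIndependent K ![x, y] → lam y ∣ lam x * f → lam y ∣ f
  deg : ∀ x g t, x ≠ 0 → lam x * g ∈ Rt t → g ∈ Rt (t - 1)

variable {K V R : Type*} [Field K] [AddCommGroup V] [Module K V] [CommRing R] [Algebra K R]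

theorem Gd.mono {k k' : ℕ} {B B' : List V} {a : V} (h : Gd (K := K) k B a) (hk : k' ≤ k)
    (hB : ∀ t ∈ B', t ∈ B) : Gd (K := K) k' B' a :=
  fun T hT hc => h T (fun t ht => hB t (hT t ht)) (hc.trans hk)

theorem Gd.ne {k : ℕ} {B : List V} {a : V} (h : Gd (K := K) k B a) : a ≠ 0 := by
  rintro rfl
  exact h ∅ (by simp) (by simp) (Submodule.zero_mem _)

theorem Gd.exch {k : ℕ} {B : List V} {a z : V} (h : Gd (K := K) k B a)
    (hz : Gd (K := K) k (a :: B) z) : Gd (K := K) k (z :: B) a := by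
  classical
  intro T hT hc hm
  by_cases hzT : z ∈ T
  · have h1 : a ∉ Submodule.span K ((T.erase z : Finset V) : Set V) := by
      apply h
      · intro t ht
        have := hT t (Finset.mem_of_mem_erase ht)
        have h2 := Finset.ne_of_mem_erase ht
        simpa [h2] using this
      · exact (Finset.card_erase_le).trans hc
    rw [← Finset.insert_erase hzT, Finset.coe_insert] at hm
    have h2 := mem_span_insert_exchange hm h1
    refine hz (insert a (T.erase z)) ?_ ?_ (by simpa using h2)
    · intro t ht
      rw [Finset.mem_insert] at ht
      rcases ht with rfl | ht
      · simp
      · have := hT t (Finset.mem_of_mem_erase ht)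
        have h2 := Finset.ne_of_mem_erase ht
        rcases List.mem_cons.1 this with h | h
        · exact absurd h h2
        · simp [h]
    · refine (Finset.card_insert_le _ _).trans ?_
      rw [Finset.card_erase_of_mem hzT]
      have := Finset.card_pos.2 ⟨z, hzT⟩
      omega
  · refine h T ?_ hc hm
    intro t ht
    rcases List.mem_cons.1 (hT t ht) with h | h
    · subst h; exact absurd ht hzT
    · exact h

theorem Gd.shift {k : ℕ} {B : List V} {x y : V} (h : Gd (K := K) (k+1) (x :: B) y) :
    Gd (K := K) k B (x + y) := by
  classical
  intro T hT hc hm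
  refine h (insert x T) ?_ ?_ ?_
  · intro t ht
    rcases Finset.mem_insert.1 ht with rfl | ht
    · simp
    · simp [hT t ht]
  · exact (Finset.card_insert_le _ _).trans (by omega)
  · rw [Finset.coe_insert]
    have h1 : x + y ∈ Submodule.span K (insert x (T : Set V)) :=
      Submodule.span_mono (Set.subset_insert _ _) hm
    have h2 : x ∈ Submodule.span K (insert x (T : Set V)) :=
      Submodule.subset_span (Set.mem_insert _ _)
    simpa using Submodule.sub_mem _ h1 h2

theorem Gd.coef {B : List V} {z : V} (h : Gd (K := K) 3 B z) {w1 w2 w3 : V}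
    (h1 : w1 ∈ B) (h2 : w2 ∈ B) (h3 : w3 ∈ B) {a b c e : K}
    (he : a • w1 + b • w2 + c • w3 + e • z = 0) : e = 0 := by
  classical
  by_contra hne
  refine h {w1, w2, w3} (by simp; tauto) (Finset.card_le_three) ?_
  have : z = e⁻¹ • (-(a • w1 + b • w2 + c • w3)) := by
    rw [← eq_neg_of_add_eq_zero_right he, smul_smul, inv_mul_cancel₀ hne, one_smul]
  rw [this]
  apply Submodule.smul_mem
  apply Submodule.neg_mem
  have m1 : w1 ∈ Submodule.span K (({w1, w2, w3} : Finset V) : Set V) :=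
    Submodule.subset_span (by simp)
  have m2 : w2 ∈ Submodule.span K (({w1, w2, w3} : Finset V) : Set V) :=
    Submodule.subset_span (by simp)
  have m3 : w3 ∈ Submodule.span K (({w1, w2, w3} : Finset V) : Set V) :=
    Submodule.subset_span (by simp)
  exact Submodule.add_mem _ (Submodule.add_mem _ (Submodule.smul_mem _ _ m1)
    (Submodule.smul_mem _ _ m2)) (Submodule.smul_mem _ _ m3)

theorem GdL.mem {Q : Set V} {k : ℕ} : ∀ {l B : List V}, GdL (K := K) Q k B l → ∀ a ∈ l,
    a ∈ Q ∧ Gd (K := K) k B a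
  | [], _, _, a, ha => by simp at ha
  | (b :: l), B, h, a, ha => by
    obtain ⟨h1, h2, h3⟩ := h
    rcases List.mem_cons.1 ha with rfl | ha
    · exact ⟨h1, h2⟩
    · obtain ⟨h4, h5⟩ := GdL.mem h3 a ha
      exact ⟨h4, h5.mono le_rfl (by intro t ht; simp [ht])⟩

theorem GdL.pw {Q : Set V} {k : ℕ} : ∀ {l B : List V}, GdL (K := K) Q k B l →
    l.Pairwise (fun a b => Gd (K := K) k (a :: B) b)
  | [], _, _ => by simp
  | (b :: l), B, h => by
    obtain ⟨h1, h2, h3⟩ := h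
    refine List.Pairwise.cons (fun a ha => (GdL.mem h3 a ha).2) ?_
    refine (GdL.pw h3).imp ?_
    intro x y hxy
    exact hxy.mono le_rfl (by intro t ht; simp at ht ⊢; tauto)

theorem GdL.exch {Q : Set V} {k : ℕ} {z : V} : ∀ {l B : List V}, GdL (K := K) Q k B l →
    Gd (K := K) k (B ++ l) z → GdL (K := K) Q k (z :: B) l
  | [], _, _, _ => trivial
  | (b :: l), B, h, hz => by
    obtain ⟨h1, h2, h3⟩ := h
    refine ⟨h1, h2.exch (hz.mono le_rfl (by intro t ht; simp at ht ⊢; tauto)), ?_⟩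
    have h4 := GdL.exch (z := z) h3 (hz.mono le_rfl (by intro t ht; simp at ht ⊢; tauto))
    refine GdL.mono' h4 ?_
    intro t ht; simp at ht ⊢; tauto
where
  GdL.mono' {Q : Set V} {k : ℕ} : ∀ {l B B' : List V}, GdL (K := K) Q k B l →
    (∀ t ∈ B', t ∈ B) → GdL (K := K) Q k B' l
  | [], _, _, _, _ => trivial
  | (b :: l), B, B', h, hB => by
    obtain ⟨h1, h2, h3⟩ := h
    refine ⟨h1, h2.mono le_rfl hB, GdL.mono' h3 ?_⟩
    intro t ht; simp at ht ⊢
    rcases ht with h | h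
    · exact Or.inl h
    · exact Or.inr (hB t h)

theorem GdL.weaken {Q Q' : Set V} {k k' : ℕ} (hk : k' ≤ k) (hQ : Q ⊆ Q') :
    ∀ {l B B' : List V}, GdL (K := K) Q k B l →
    (∀ t ∈ B', t ∈ B) → GdL (K := K) Q' k' B' l
  | [], _, _, _, _ => trivial
  | (b :: l), B, B', h, hB => by
    obtain ⟨h1, h2, h3⟩ := h
    refine ⟨hQ h1, h2.mono hk hB, GdL.weaken hk hQ h3 ?_⟩
    intro t ht; simp at ht ⊢
    rcases ht with h | h
    · exact Or.inl h
    · exact Or.inr (hB t h)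

theorem GdL.exists {Q : Set V} {k m : ℕ}
    (gen : ∀ B : List V, B.length ≤ m → ∃ z ∈ Q, Gd (K := K) k B z) :
    ∀ (n : ℕ) (B : List V), B.length + n ≤ m → ∃ l : List V, l.length = n ∧ GdL (K := K) Q k B l
  | 0, _, _ => ⟨[], rfl, trivial⟩
  | n + 1, B, h => by
    obtain ⟨z, hz, hg⟩ := gen B (by omega)
    obtain ⟨l, hl, hl2⟩ := GdL.exists gen n (z :: B) (by simp; omega)
    exact ⟨z :: l, by simp [hl], hz, hg, hl2⟩

theorem lemV {m : R} : ∀ (xs : List R),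
    xs.Pairwise (fun x y => ∀ r, m ∣ (y - x) * r → m ∣ r) →
    ∀ G : R[X], (∀ i, xs.length ≤ i → G.coeff i = 0) → (∀ x ∈ xs, m ∣ G.eval x) →
    ∀ i, m ∣ G.coeff i
  | [], _, G, h, _, i => by rw [h i (by simp)]; exact dvd_zero _
  | (x :: xs), hp, G, h, hx, i => by
    rw [List.pairwise_cons] at hp
    obtain ⟨hp1, hp2⟩ := hp
    nontriviality R
    set Q := G /ₘ (X - C x) with hQ
    have e : C (G.eval x) + (X - C x) * Q = G := by
      rw [← modByMonic_X_sub_C_eq_C_eval]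
      exact modByMonic_add_div G _
    have hQc : ∀ i, xs.length ≤ i → Q.coeff i = 0 := by
      have hGd : G.natDegree ≤ xs.length := by
        rw [natDegree_le_iff_coeff_eq_zero]
        intro N hN
        exact h N (by simp; omega)
      intro i hi
      by_cases h0 : G.natDegree = 0
      · have : Q = 0 := by
          rw [hQ, divByMonic_eq_zero_iff (monic_X_sub_C x), degree_X_sub_C]
          rw [Polynomial.eq_C_of_natDegree_eq_zero h0]
          exact lt_of_le_of_lt degree_C_le (by norm_num)
        rw [this, coeff_zero]
      · apply coeff_eq_zero_of_natDegree_lt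
        rw [hQ, natDegree_divByMonic _ (monic_X_sub_C x), natDegree_X_sub_C]
        omega
    have ih := lemV xs hp2 Q hQc (by
      intro y hy
      apply hp1 y hy
      have h1 := hx y (by simp [hy])
      have h2 := hx x (by simp)
      rw [← e] at h1
      simp only [eval_add, eval_C, eval_mul, eval_sub, eval_X] at h1
      exact (dvd_add_right h2).1 h1)
    rw [← e]
    have h2 := hx x (by simp)
    rw [coeff_add, sub_mul, coeff_sub, coeff_C_mul]
    refine dvd_add ?_ (dvd_sub ?_ (Dvd.dvd.mul_left (ih i) _))
    · rw [coeff_C]; split_ifs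
      · exact h2
      · exact dvd_zero _
    · cases i with
      | zero => simp
      | succ j => rw [coeff_X_mul]; exact ih j

variable {lam : V →ₗ[K] R} {Rt : ℤ → Submodule K R}

theorem lemP3 (hA : Ax lam Rt) : ∀ (xs : List V) (t : ℤ) (e : R), t < xs.length →
    (∀ x ∈ xs, x ≠ 0) → xs.Pairwise (fun x y => LinearIndependent K ![x, y]) → e ∈ Rt t →
    (∀ x ∈ xs, lam x ∣ e) → e = 0
  | [], t, e, ht, _, _, he, _ => hA.neg t e (by simpa using ht) he
  | (x :: xs), t, e, ht, h0, hp, he, hd => by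
    rw [List.pairwise_cons] at hp
    obtain ⟨g, rfl⟩ := hd x (by simp)
    have := lemP3 hA xs (t - 1) g (by simp at ht; omega) (fun y hy => h0 y (by simp [hy])) hp.2
      (hA.deg x g t (h0 x (by simp)) he)
      (fun y hy => hA.reg2 x y g (hp.1 y hy) (hd y (by simp [hy])))
    rw [this, mul_zero]

def HP (Rt : ℤ → Submodule K R) (t : ℤ) (G : R[X]) : Prop := ∀ i : ℕ, G.coeff i ∈ Rt (t - i)

theorem Ax.pow (hA : Ax lam Rt) (x : V) (f : R) (t : ℤ) (hf : f ∈ Rt t) (n : ℕ) :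
    f * lam x ^ n ∈ Rt (t + n) := by
  induction n with
  | zero => simpa using hf
  | succ n ih =>
    have := hA.mul x _ _ ih
    rw [pow_succ, ← mul_assoc, mul_comm (f * _)]
    convert this using 2
    push_cast; ring

theorem HP.evl (hA : Ax lam Rt) {t : ℤ} {G : R[X]} (h : HP Rt t G) (x : V) :
    G.eval (lam x) ∈ Rt t := by
  rw [eval_eq_sum_range]
  refine Submodule.sum_mem _ fun i _ => ?_
  have := hA.pow x _ _ (h i) i
  simpa using this

theorem HP.coeff0 (hA : Ax lam Rt) {t : ℤ} {G : R[X]} (h : HP Rt t G) (i : ℕ) (hi : t < i) :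
    G.coeff i = 0 := hA.neg _ _ (by omega) (h i)

theorem HP.add {t : ℤ} {G G' : R[X]} (h : HP Rt t G) (h' : HP Rt t G') : HP Rt t (G + G') :=
  fun i => by rw [coeff_add]; exact Submodule.add_mem _ (h i) (h' i)
theorem HP.sub {t : ℤ} {G G' : R[X]} (h : HP Rt t G) (h' : HP Rt t G') : HP Rt t (G - G') :=
  fun i => by rw [coeff_sub]; exact Submodule.sub_mem _ (h i) (h' i)
theorem HP.cst {t : ℤ} {r : R} (h : r ∈ Rt t) : HP Rt t (C r) :=
  fun i => by
    rw [coeff_C]; split_ifs with hi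
    · subst hi; simpa using h
    · exact Submodule.zero_mem _
theorem HP.mulX {t : ℤ} {G : R[X]} (h : HP Rt t G) : HP Rt (t + 1) (X * G) :=
  fun i => by
    cases i with
    | zero => simp
    | succ j =>
      rw [coeff_X_mul]
      convert h j using 2
      push_cast; ring
theorem HP.Cmul (hA : Ax lam Rt) {t : ℤ} {G : R[X]} (h : HP Rt t G) (x : V) :
    HP Rt (t + 1) (Polynomial.C (lam x) * G) :=
  fun i => by
    rw [coeff_C_mul]
    convert hA.mul x _ _ (h i) using 2
    ring
theorem HP.tayl (hA : Ax lam Rt) {t : ℤ} {G : R[X]} (h : HP Rt t G) (x : V) :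
    HP Rt t (taylor (lam x) G) :=
  fun i => by
    rw [taylor_coeff]
    apply HP.evl hA
    intro j
    rw [hasseDeriv_coeff, ← nsmul_eq_mul]
    apply nsmul_mem
    convert h (j + i) using 2
    push_cast; ring

theorem newton (hA : Ax lam Rt) {Q : Set V} : ∀ (l B : List V) (t : ℤ) (g : V → R),
    t < l.length →
    (∀ a ∈ Q, Gd (K := K) 3 B a → g a ∈ Rt t) →
    (∀ a ∈ Q, ∀ b ∈ Q, Gd (K := K) 3 B a → Gd (K := K) 3 (a :: B) b → lam (a - b) ∣ g a - g b) →
    GdL (K := K) Q 3 B l →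
    ∃ G : R[X], HP Rt t G ∧ (∀ a ∈ l, g a = G.eval (lam a)) ∧
      ∀ a ∈ Q, Gd (K := K) 3 (B ++ l) a → g a = G.eval (lam a)
  | [], B, t, g, ht, hg, _, _ => by
    refine ⟨0, ?_, by simp, ?_⟩
    · intro i; simp
    · intro a ha hB
      simp only [List.append_nil] at hB
      simpa using hA.neg t _ (by simpa using ht) (hg a ha hB)
  | (a0 :: l), B, t, g, ht, hg, hr, hl => by
    classical
    obtain ⟨h1, h2, h3⟩ := hl
    have key : ∀ a, ∃ r, a ∈ Q → Gd (K := K) 3 (a0 :: B) a → g a = g a0 + lam (a - a0) * r := by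
      intro a
      by_cases h : a ∈ Q ∧ Gd (K := K) 3 (a0 :: B) a
      · obtain ⟨r, hr'⟩ := hr a0 h1 a h.1 h2 h.2
        refine ⟨r, fun _ _ => ?_⟩
        have e : lam (a - a0) = - lam (a0 - a) := by rw [← map_neg]; congr 1; abel
        rw [e]; linear_combination -hr'
      · exact ⟨0, fun h4 h5 => absurd ⟨h4, h5⟩ h⟩
    choose g1 hg1 using key
    have hne : ∀ a, Gd (K := K) 3 (a0 :: B) a → a - a0 ≠ 0 := by
      intro a h hh
      have : (1:K) = 0 := h.coef (w1 := a0) (w2 := a0) (w3 := a0) (by simp) (by simp) (by simp)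
        (a := -1) (b := 0) (c := 0) (e := 1) (by rw [← hh]; module)
      exact one_ne_zero this
    obtain ⟨G, hG, hG1, hG2⟩ := newton hA l (a0 :: B) (t - 1) g1 (by simp at ht; omega) (by
      intro a ha hga
      apply hA.deg (a - a0) _ _ (hne a hga)
      have := hg1 a ha hga
      rw [← sub_eq_iff_eq_add'] at this
      rw [← this]
      exact Submodule.sub_mem _ (hg a ha (hga.mono le_rfl (by intro t ht; simp [ht])))
        (hg a0 h1 h2)) (by
      intro a ha b hb hga hgb
      have hgb' : Gd (K := K) 3 (a0 :: B) b := hgb.mono le_rfl (by intro t ht; simp at ht ⊢; tauto)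
      have e1 := hg1 a ha hga
      have e2 := hg1 b hb hgb'
      apply hA.reg2 (a - a0) (a - b)
      · rw [LinearIndependent.pair_iff]
        intro α β hab
        have hβ : -β = 0 := hgb.coef (w1 := a) (w2 := a0) (w3 := a) (by simp) (by simp) (by simp)
          (a := α + β) (b := -α) (c := 0) (by rw [← hab]; module)
        have hβ : β = 0 := by simpa using hβ
        subst hβ
        refine ⟨?_, rfl⟩
        exact hga.coef (w1 := a0) (w2 := a0) (w3 := a0) (by simp) (by simp) (by simp)
          (a := -α) (b := 0) (c := 0) (by rw [← hab]; module)
      · obtain ⟨r, hr'⟩ := hr a ha b hb (hga.mono le_rfl (by intro t ht; simp [ht]))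
          (hgb.mono le_rfl (by intro t ht; simp at ht ⊢; tauto))
        refine ⟨r - g1 b, ?_⟩
        simp only [map_sub] at *
        linear_combination hr' - e1 + e2) h3
    refine ⟨C (g a0) + (X * G - C (lam a0) * G), ?_, ?_, ?_⟩
    · apply HP.add (HP.cst (hg a0 h1 h2))
      have := (HP.mulX hG).sub (HP.Cmul hA hG a0)
      simpa using this
    · intro a ha
      rcases List.mem_cons.1 ha with rfl | ha
      · simp
      · obtain ⟨h4, h5⟩ := GdL.mem h3 a ha
        rw [hg1 a h4 h5, hG1 a ha]
        simp; ring
    · intro a ha hga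
      rw [hg1 a ha (hga.mono le_rfl (by intro t ht; simp at ht ⊢; tauto)),
        hG2 a ha (hga.mono le_rfl (by intro t ht; simp at ht ⊢; tauto))]
      simp; ring

end Polynomial.S14

namespace Polynomial.S14

variable {K V R : Type*} [Field K] [AddCommGroup V] [Module K V] [CommRing R] [Algebra K R]
variable {lam : V →ₗ[K] R} {Rt : ℤ → Submodule K R}

theorem indep_one {B : List V} {a z : V} (ha : a ≠ 0) (h : Gd (K := K) 3 B z) (hB : a ∈ B) :
    ∀ α γ : K, α • a + γ • z = 0 → α = 0 ∧ γ = 0 := by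
  intro α γ e
  have hγ : γ = 0 := h.coef (w1 := a) (w2 := a) (w3 := a) hB hB hB
    (a := α) (b := 0) (c := 0) (by rw [← e]; module)
  subst hγ
  simp only [zero_smul, add_zero, smul_eq_zero] at e
  exact ⟨e.resolve_right ha, rfl⟩

theorem li_one {B : List V} {a z : V} (ha : a ≠ 0) (h : Gd (K := K) 3 B z) (hB : a ∈ B) :
    LinearIndependent K ![a, z] := by
  rw [LinearIndependent.pair_iff]
  exact indep_one ha h hB

theorem li_swap {a b : V} (h : LinearIndependent K ![a, b]) : LinearIndependent K ![b, a] := by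
  rw [LinearIndependent.pair_iff] at *
  intro s t e
  have := h t s (by rw [← e]; abel)
  exact ⟨this.2, this.1⟩

theorem stepH (hA : Ax lam Rt) {x z : V} {s : ℤ} {f : R} (hf : f ∈ Rt s)
    (hxz : LinearIndependent K ![x, z]) (h1 : lam x ∣ f) (h2 : lam z ∣ f) :
    ∃ h ∈ Rt (s - 2), f = lam x * lam z * h := by
  have hx : x ≠ 0 := hxz.ne_zero 0
  have hz : z ≠ 0 := hxz.ne_zero 1
  obtain ⟨g, rfl⟩ := h1
  have hg := hA.deg x g s hx hf
  obtain ⟨h, rfl⟩ := hA.reg2 x z g hxz h2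
  refine ⟨h, ?_, by ring⟩
  have := hA.deg z h _ hz hg
  rwa [show s - 1 - 1 = s - 2 by ring] at this

structure Sys (lam : V →ₗ[K] R) (Rt : ℤ → Submodule K R) (P : ℝ → Set V) (s : ℕ) (F : V → R)
    (H : V → V → R) : Prop where
  ax : Ax lam Rt
  add : ∀ a b c x y, x ∈ P a → y ∈ P b → a + b ≤ c → x + y ∈ P c
  ngP : ∀ a x, x ∈ P a → -x ∈ P a
  mono : ∀ a b, a ≤ b → P a ⊆ P b
  char : ∀ i : ℕ, 1 ≤ i → i ≤ s → (i : K) ≠ 0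
  gen : ∀ B : List V, B.length ≤ 10 * s + 20 → ∃ z ∈ P (1/32), Gd (K := K) 8 B z
  hF : ∀ x ∈ P 1, F x ∈ Rt s
  hH : ∀ x z, x ∈ P (1/2) → z ∈ P (1/2) → LinearIndependent K ![x, z] →
    H x z ∈ Rt (s - 2) ∧ F x + F z - F (x + z) = lam x * lam z * H x z

variable {P : ℝ → Set V} {s : ℕ} {F : V → R} {H : V → V → R}

theorem Sys.symm (S : Sys lam Rt P s F H) {x z : V} (hx : x ∈ P (1/2)) (hz : z ∈ P (1/2))
    (h : LinearIndependent K ![x, z]) : H x z = H z x := by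
  have e1 := (S.hH x z hx hz h).2
  have e2 := (S.hH z x hz hx (li_swap h)).2
  rw [add_comm z x] at e2
  have := S.ax.reg x (lam z * (H x z - H z x)) (h.ne_zero 0) (by linear_combination e2 - e1)
  have := S.ax.reg z _ (h.ne_zero 1) this
  exact sub_eq_zero.1 this

theorem Sys.rel (S : Sys lam Rt P s F H) {a b z : V} (ha : a ∈ P (1/4)) (hb : b ∈ P (1/4))
    (hz : z ∈ P (1/4))
    (h3 : ∀ α β γ : K, α • a + β • b + γ • z = 0 → α = 0 ∧ β = 0 ∧ γ = 0) :
    lam (a - b) ∣ H a z - H b z := by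
  have q : P (1/4) ⊆ P (1/2) := S.mono _ _ (by norm_num)
  have l1 : LinearIndependent K ![b, z] := by
    rw [LinearIndependent.pair_iff]; intro α β e
    have := h3 0 α β (by rw [← e]; module); tauto
  have l2 : LinearIndependent K ![a, z] := by
    rw [LinearIndependent.pair_iff]; intro α β e
    have := h3 α 0 β (by rw [← e]; module); tauto
  have l3 : LinearIndependent K ![a - b, b] := by
    rw [LinearIndependent.pair_iff]; intro α β e
    obtain ⟨h4, h5, h6⟩ := h3 α (β - α) 0 (by rw [← e]; module)
    subst h4; simp at h5; tauto
  have l4 : LinearIndependent K ![a - b, b + z] := by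
    rw [LinearIndependent.pair_iff]; intro α β e
    have := h3 α (β - α) β (by rw [← e]; module); tauto
  have l5 : LinearIndependent K ![z, a - b] := by
    rw [LinearIndependent.pair_iff]; intro α β e
    have := h3 β (-β) α (by rw [← e]; module); tauto
  have m1 : a - b ∈ P (1/2) := by
    rw [sub_eq_add_neg]; exact S.add _ _ _ _ _ ha (S.ngP _ _ hb) (by norm_num)
  have m2 : b + z ∈ P (1/2) := S.add _ _ _ _ _ hb hz (by norm_num)
  have e1 := (S.hH _ _ (q hb) (q hz) l1).2
  have e2 := (S.hH _ _ (q ha) (q hz) l2).2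
  have e3 := (S.hH _ _ m1 (q hb) l3).2
  have e4 := (S.hH _ _ m1 m2 l4).2
  rw [sub_add_cancel] at e3
  rw [show a - b + (b + z) = a + z by abel] at e4
  apply S.ax.reg2 b _ _ (li_swap l3)
  apply S.ax.reg2 z _ _ l5
  refine ⟨lam (b + z) * H (a - b) (b + z) - lam b * H (a - b) b - lam z * H a z, ?_⟩
  simp only [map_sub, map_add] at *
  linear_combination e4 + e1 - e2 - e3

theorem Sys.step1 (S : Sys lam Rt P s F H) {l : List V} (hl : GdL (K := K) (P (1/4)) 3 [] l)
    (hls : l.length = s) {z : V} (hz : z ∈ P (1/4)) (hzl : Gd (K := K) 3 l z) :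
    ∃ G : R[X], HP Rt (s - 2) G ∧ (∀ a ∈ l, H a z = G.eval (lam a)) ∧
      ∀ a ∈ P (1/4), Gd (K := K) 3 (z :: l) a → H a z = G.eval (lam a) := by
  have q : P (1/4) ⊆ P (1/2) := S.mono _ _ (by norm_num)
  refine newton S.ax l [z] (s - 2) (fun a => H a z) (by omega) ?_ ?_ (hl.exch (by simpa using hzl))
  · intro a ha hga
    exact (S.hH _ _ (q ha) (q hz) (li_swap (li_one hzl.ne hga (by simp)))).1
  · intro a ha b hb hga hgb
    apply S.rel ha hb hz
    intro α β γ e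
    have hβ : β = 0 := hgb.coef (w1 := a) (w2 := z) (w3 := z) (by simp) (by simp) (by simp)
      (a := α) (b := γ) (c := 0) (by rw [← e]; module)
    subst hβ
    have := indep_one hzl.ne hga (by simp) γ α (by rw [← e]; module)
    tauto

theorem Sys.step2 (S : Sys lam Rt P s F H) {l : List V} (hl : GdL (K := K) (P (1/4)) 3 [] l)
    (hls : l.length = s) {z z' : V} (hz : z ∈ P (1/4)) (hzl : Gd (K := K) 3 l z)
    (hz' : z' ∈ P (1/4)) (hzl' : Gd (K := K) 3 (z :: l) z') {G G' : R[X]}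
    (hG : HP Rt (s - 2) G) (hG1 : ∀ a ∈ l, H a z = G.eval (lam a))
    (hG' : HP Rt (s - 2) G') (hG1' : ∀ a ∈ l, H a z' = G'.eval (lam a)) :
    lam (z - z') ∣ G.coeff 0 - G'.coeff 0 := by
  have q : P (1/4) ⊆ P (1/2) := S.mono _ _ (by norm_num)
  rw [← coeff_sub]
  apply lemV (l.map lam)
  · rw [List.pairwise_map]
    have hp := hl.pw
    refine hp.imp_of_mem ?_
    intro a b ha hb hab r
    rw [← map_sub]
    apply S.ax.reg2
    rw [LinearIndependent.pair_iff]; intro α β e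
    have h1 : -β = 0 := hzl'.coef (w1 := z) (w2 := a) (w3 := b) (by simp) (by simp [ha])
      (by simp [hb]) (a := β) (b := -α) (c := α) (by rw [← e]; module)
    have h1 : β = 0 := by simpa using h1
    subst h1
    have := indep_one ((hl.mem a ha).2.ne) hab (by simp) (-α) α (by rw [← e]; module)
    tauto
  · intro i hi
    apply (hG.sub hG').coeff0 S.ax
    simp at hi; omega
  · intro r hr
    obtain ⟨a, ha, rfl⟩ := List.mem_map.1 hr
    obtain ⟨haP, hag⟩ := hl.mem a ha
    rw [eval_sub, ← hG1 a ha, ← hG1' a ha]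
    rw [S.symm (q haP) (q hz) (li_one hag.ne hzl ha),
      S.symm (q haP) (q hz') (li_one hag.ne hzl' (by simp [ha]))]
    apply S.rel hz hz' haP
    intro α β γ e
    have hβ : β = 0 := hzl'.coef (w1 := z) (w2 := a) (w3 := a) (by simp) (by simp [ha])
      (by simp [ha]) (a := α) (b := γ) (c := 0) (by rw [← e]; module)
    subst hβ
    have := indep_one hag.ne hzl ha γ α (by rw [← e]; module)
    tauto

def WW (s : ℕ) (c : ℕ → R) : R[X] := X ^ 2 * ∑ i ∈ Finset.range (s + 1), C (c i) * X ^ i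

theorem WW_eval (c : ℕ → R) (r : R) :
    (WW s c).eval r = r ^ 2 * ∑ i ∈ Finset.range (s + 1), c i * r ^ i := by
  simp [WW, eval_finsetSum]

theorem WW_coeff (c : ℕ → R) (hc : ∀ i, s < i → c i = 0) (i : ℕ) :
    (WW s c).coeff (i + 2) = c i := by
  rw [WW, coeff_X_pow_mul, finsetSum_coeff]
  simp only [coeff_C_mul_X_pow]
  rw [Finset.sum_ite_eq]
  split_ifs with h
  · rfl
  · rw [hc i (by simp at h; omega)]

theorem WW_coeff0 (c : ℕ → R) (i : ℕ) (hi : i < 2) : (WW s c).coeff i = 0 := by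
  rw [WW, coeff_X_pow_mul', if_neg (by omega)]

theorem WW_HP (c : ℕ → R) (hc : ∀ i, s < i → c i = 0)
    (hc' : ∀ i : ℕ, c i ∈ Rt (s - 2 - i)) : HP Rt s (WW s c) := by
  intro i
  rcases lt_or_ge i 2 with h | h
  · rw [WW_coeff0 c i h]; exact Submodule.zero_mem _
  · obtain ⟨j, rfl⟩ := Nat.exists_eq_add_of_le' h
    rw [WW_coeff c hc]
    convert hc' j using 2
    push_cast; ring

theorem Sys.step3 (S : Sys lam Rt P s F H) : ∃ (l B : List V) (Gz : V → R[X]) (c : ℕ → R),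
    l ⊆ B ∧ B.length = 2 * s ∧ (∀ i : ℕ, c i ∈ Rt (s - 2 - i)) ∧ HP Rt s (WW s c) ∧
    (∀ z ∈ P (1/4), Gd (K := K) 3 l z → HP Rt (s - 2) (Gz z) ∧
      ∀ a ∈ P (1/4), Gd (K := K) 3 (z :: l) a → H a z = (Gz z).eval (lam a)) ∧
    (∀ z ∈ P (1/4), Gd (K := K) 3 B z →
      lam z * (Gz z).coeff 0 = - (derivative (WW s c)).eval (lam z)) := by
  classical
  have q : P (1/32) ⊆ P (1/4) := S.mono _ _ (by norm_num)
  obtain ⟨l, hls, hl⟩ := GdL.exists S.gen s [] (by simp; omega)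
  obtain ⟨l2, hls2, hl2⟩ := GdL.exists S.gen s l (by omega)
  have hl := hl.weaken (k' := 3) (by norm_num) q (B' := []) (by simp)
  have hl2 := hl2.weaken (k' := 3) (by norm_num) q (B' := l) (by simp)
  have key : ∀ z, ∃ G : R[X], z ∈ P (1/4) → Gd (K := K) 3 l z →
      HP Rt (s - 2) G ∧ (∀ a ∈ l, H a z = G.eval (lam a)) ∧
      ∀ a ∈ P (1/4), Gd (K := K) 3 (z :: l) a → H a z = G.eval (lam a) := by
    intro z
    by_cases h : z ∈ P (1/4) ∧ Gd (K := K) 3 l z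
    · obtain ⟨G, hG⟩ := S.step1 hl hls h.1 h.2
      exact ⟨G, fun _ _ => hG⟩
    · exact ⟨0, fun h1 h2 => absurd ⟨h1, h2⟩ h⟩
  choose Gz hGz using key
  obtain ⟨E, hE, -, hE2⟩ := newton S.ax l2 l (s - 2) (fun z => (Gz z).coeff 0) (by omega)
    (by
      intro a ha hga
      simpa using (hGz a ha hga).1 0)
    (by
      intro a ha b hb hga hgb
      have hgb' : Gd (K := K) 3 l b := hgb.mono le_rfl (by intro t ht; simp [ht])
      exact S.step2 hl hls ha hga hb hgb (hGz a ha hga).1 (hGz a ha hga).2.1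
        (hGz b hb hgb').1 (hGz b hb hgb').2.1) hl2
  have hE0 : ∀ i : ℕ, s < i + 2 → E.coeff i = 0 := fun i hi => hE.coeff0 S.ax i (by omega)
  let c : ℕ → R := fun i => -(((i + 2 : ℕ) : K)⁻¹ • E.coeff i)
  have hc0 : ∀ i, s < i + 2 → c i = 0 := fun i hi => by simp [c, hE0 i hi]
  have hc1 : ∀ i : ℕ, c i ∈ Rt (s - 2 - i) := fun i =>
    Submodule.neg_mem _ (Submodule.smul_mem _ _ (hE i))
  have hd : derivative (WW s c) = -(X * E) := by
    ext n
    rw [coeff_derivative, coeff_neg]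
    cases n with
    | zero => simp [WW_coeff0 (s := s) c 1 (by norm_num)]
    | succ i =>
      rw [coeff_X_mul, WW_coeff c (fun i hi => hc0 i (by omega))]
      by_cases hi : s < i + 2
      · rw [hc0 i hi, hE0 i hi]; simp
      · have h1 := S.char (i + 2) (by omega) (by omega)
        have h2 : (((i + 1 : ℕ) : R) + 1) = algebraMap K R ((i + 2 : ℕ) : K) := by
          rw [map_natCast]; push_cast; ring
        rw [h2, mul_comm, ← Algebra.smul_def]
        simp only [c, smul_neg, smul_smul, mul_inv_cancel₀ h1, one_smul]
  refine ⟨l, l ++ l2, Gz, c, by simp, by simp; omega, hc1,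
    WW_HP c (fun i hi => hc0 i (by omega)) hc1, ?_, ?_⟩
  · intro z hz hgz
    exact ⟨(hGz z hz hgz).1, (hGz z hz hgz).2.2⟩
  · intro z hz hgz
    rw [hd]
    have := hE2 z hz hgz
    rw [this]; simp

end Polynomial.S14

namespace Polynomial.S14

variable {K V R : Type*} [Field K] [AddCommGroup V] [Module K V] [CommRing R] [Algebra K R]
variable {lam : V →ₗ[K] R} {Rt : ℤ → Submodule K R}
variable {P : ℝ → Set V} {s : ℕ} {F : V → R} {H : V → V → R}

def Ft (lam : V →ₗ[K] R) (F : V → R) (W : R[X]) (x : V) : R := F x - W.eval (lam x)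

def cc (lam : V →ₗ[K] R) (F : V → R) (W : R[X]) (x y : V) : R :=
  Ft lam F W x + Ft lam F W y - Ft lam F W (x + y)

theorem cc_symm (W : R[X]) (x y : V) : cc lam F W x y = cc lam F W y x := by
  unfold cc; rw [add_comm y x]; ring

theorem cc_cocycle (W : R[X]) (x y z : V) :
    cc lam F W x y + cc lam F W (x + y) z = cc lam F W y z + cc lam F W x (y + z) := by
  unfold cc; rw [add_assoc x y z]; ring

def Ph (W G : R[X]) (r : R) : R[X] := X * (C r * G) - (W + C (W.eval r) - taylor r W)

structure Sys2 (lam : V →ₗ[K] R) (Rt : ℤ → Submodule K R) (P : ℝ → Set V) (s : ℕ) (F : V → R)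
    (H : V → V → R) (l B : List V) (Gz : V → R[X]) (W : R[X]) : Prop
    extends Sys lam Rt P s F H where
  lB : l ⊆ B
  Bl : B.length = 2 * s
  hW : HP Rt s W
  hW0 : W.coeff 0 = 0
  hW1 : W.coeff 1 = 0
  hG : ∀ z ∈ P (1/4), Gd (K := K) 3 l z → HP Rt (s - 2) (Gz z) ∧
      ∀ a ∈ P (1/4), Gd (K := K) 3 (z :: l) a → H a z = (Gz z).eval (lam a)
  hD : ∀ z ∈ P (1/4), Gd (K := K) 3 B z →
      lam z * (Gz z).coeff 0 = - (derivative W).eval (lam z)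

variable {l B : List V} {Gz : V → R[X]} {W : R[X]}

theorem Sys2.cc_mem (S : Sys2 lam Rt P s F H l B Gz W) {x y : V} (hx : x ∈ P (1/2))
    (hy : y ∈ P (1/2)) : cc lam F W x y ∈ Rt s := by
  have h : ∀ x ∈ P 1, Ft lam F W x ∈ Rt s := fun x hx =>
    Submodule.sub_mem _ (S.hF x hx) (S.hW.evl S.ax x)
  exact Submodule.sub_mem _ (Submodule.add_mem _ (h _ (S.mono _ _ (by norm_num) hx))
    (h _ (S.mono _ _ (by norm_num) hy))) (h _ (S.add _ _ _ _ _ hx hy (by norm_num)))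

theorem Sys2.cc_dvd (S : Sys2 lam Rt P s F H l B Gz W) {x y : V} (hx : x ∈ P (1/2))
    (hy : y ∈ P (1/2)) (h : LinearIndependent K ![x, y]) : lam y ∣ cc lam F W x y := by
  have e := (S.hH x y hx hy h).2
  have h1 : lam y ∣ W.eval (lam y) := by
    have := sub_dvd_eval_sub (lam y) 0 W
    rwa [sub_zero, ← coeff_zero_eq_eval_zero, S.hW0, sub_zero] at this
  have h2 : lam y ∣ W.eval (lam (x + y)) - W.eval (lam x) := by
    have := sub_dvd_eval_sub (lam (x + y)) (lam x) W
    rw [map_add]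
    rwa [map_add, add_sub_cancel_left] at this
  have h3 : cc lam F W x y = lam y * (lam x * H x y) - W.eval (lam y) +
      (W.eval (lam (x + y)) - W.eval (lam x)) := by
    unfold cc Ft
    linear_combination e
  rw [h3]
  exact dvd_add (dvd_sub (dvd_mul_right _ _) h1) h2

theorem Sys2.cc_eval (S : Sys2 lam Rt P s F H l B Gz W) {x z : V} (hx : x ∈ P (1/4))
    (hz : z ∈ P (1/4)) (hzB : Gd (K := K) 3 B z) (hxz : Gd (K := K) 3 (z :: l) x) :
    cc lam F W x z = (Ph W (Gz z) (lam z)).eval (lam x) := by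
  have q : P (1/4) ⊆ P (1/2) := S.mono _ _ (by norm_num)
  have hzl : Gd (K := K) 3 l z := hzB.mono le_rfl (fun t ht => S.lB ht)
  have e := (S.hH x z (q hx) (q hz) (li_swap (li_one hzl.ne hxz (by simp)))).2
  rw [(S.hG z hz hzl).2 x hx hxz] at e
  unfold Ph cc Ft
  rw [taylor_apply]
  simp only [eval_sub, eval_mul, eval_add, eval_X, eval_C, eval_comp, map_add]
  linear_combination e

theorem Sys2.ph (S : Sys2 lam Rt P s F H l B Gz W) {z : V}
    (hz : z ∈ P (1/4)) (hzB : Gd (K := K) 3 B z) :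
    HP Rt s (Ph W (Gz z) (lam z)) ∧ (Ph W (Gz z) (lam z)).coeff 0 = 0 ∧
      (Ph W (Gz z) (lam z)).coeff 1 = 0 := by
  have hzl : Gd (K := K) 3 l z := hzB.mono le_rfl (fun t ht => S.lB ht)
  refine ⟨?_, ?_, ?_⟩
  · refine HP.sub ?_ (HP.sub (HP.add S.hW (HP.cst (S.hW.evl S.ax z))) (S.hW.tayl S.ax z))
    have := (((S.hG z hz hzl).1).Cmul S.ax z).mulX
    convert this using 1
    ring
  · simp [Ph, S.hW0, taylor_coeff_zero]
  · have h : (X * (C (lam z) * Gz z)).coeff 1 = lam z * (Gz z).coeff 0 := by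
      rw [show (1:ℕ) = 0 + 1 from rfl, coeff_X_mul, coeff_C_mul]
    simp only [Ph, coeff_sub, coeff_add, h, S.hD z hz hzB, S.hW1, taylor_coeff_one]
    rw [coeff_C_of_ne_zero (by norm_num)]
    ring

theorem dvd_sq_eval {G : R[X]} (h0 : G.coeff 0 = 0) (h1 : G.coeff 1 = 0) (r : R) :
    r ^ 2 ∣ G.eval r := by
  have : X ^ 2 ∣ G := by
    rw [X_pow_dvd_iff]
    intro d hd
    interval_cases d <;> assumption
  obtain ⟨Q, rfl⟩ := this
  simp

theorem Sys2.step4 (S : Sys2 lam Rt P s F H l B Gz W) {z : V}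
    (hz : z ∈ P (1/8)) (hzB : Gd (K := K) 3 B z) : Ph W (Gz z) (lam z) = 0 := by
  have q4 : P (1/8) ⊆ P (1/4) := S.mono _ _ (by norm_num)
  have q8 : P (1/32) ⊆ P (1/8) := S.mono _ _ (by norm_num)
  obtain ⟨hP, hP0, hP1⟩ := S.ph (q4 hz) hzB
  set Φ := Ph W (Gz z) (lam z) with hΦ
  have hBl := S.Bl
  obtain ⟨ys, hys, hysG⟩ := GdL.exists S.gen (s + 1) (z :: B) (by simp; omega)
  obtain ⟨xs, hxs, hxsG⟩ := GdL.exists S.gen (s + 1) (ys.map (· + z) ++ ys ++ z :: B)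
    (by simp; omega)
  have key : ∀ x ∈ xs, ∀ y ∈ ys, lam x ∣ (derivative Φ).eval (lam y) := by
    intro x hx y hy
    obtain ⟨hxP, hxG⟩ := hxsG.mem x hx
    obtain ⟨hyP, hyG⟩ := hysG.mem y hy
    have lB : ∀ t, t ∈ l → t ∈ B := fun t ht => S.lB ht
    have g1 : Gd (K := K) 3 B y := hyG.mono (by norm_num) (by intro t ht; simp [ht])
    have g2 : Gd (K := K) 3 B (y + z) := by
      rw [add_comm]; apply Gd.shift
      exact hyG.mono (by norm_num) (by intro t ht; simpa using ht)
    have hyz : y + z ∈ P (1/4) := S.add _ _ _ _ _ (q8 hyP) hz (by norm_num)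
    have hxy : x + y ∈ P (1/4) := S.add _ _ _ _ _ (q8 hxP) (q8 hyP) (by norm_num)
    have e1 := S.cc_eval (q4 (q8 hxP)) (q4 (q8 hyP)) g1 (hxG.mono (by norm_num) (by
      intro t ht; simp at ht ⊢
      rcases ht with rfl | h
      · tauto
      · have := lB t h; tauto))
    have e2 := S.cc_eval hxy (q4 hz) hzB (by
      rw [add_comm]; apply Gd.shift
      exact hxG.mono (by norm_num) (by
        intro t ht; simp at ht ⊢
        rcases ht with rfl | rfl | h
        · tauto
        · tauto
        · have := lB t h; tauto))
    have e3 := S.cc_eval (q4 (q8 hyP)) (q4 hz) hzB (hyG.mono (by norm_num) (by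
      intro t ht; simp at ht ⊢
      rcases ht with rfl | h
      · tauto
      · have := lB t h; tauto))
    have e4 := S.cc_eval (q4 (q8 hxP)) hyz g2 (hxG.mono (by norm_num) (by
      intro t ht; simp only [List.mem_cons, List.mem_append, List.mem_map] at ht ⊢
      rcases ht with rfl | h
      · exact Or.inl (Or.inl ⟨y, hy, rfl⟩)
      · have := lB t h; tauto))
    have c := cc_cocycle (lam := lam) (F := F) W x y z
    obtain ⟨-, a0, a1⟩ := S.ph (q4 (q8 hyP)) g1
    obtain ⟨-, b0, b1⟩ := S.ph hyz g2
    have d1 := dvd_sq_eval a0 a1 (lam x)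
    have d2 := dvd_sq_eval b0 b1 (lam x)
    rw [← e1] at d1
    rw [← e4] at d2
    rw [← hΦ] at e2 e3
    obtain ⟨k, hk⟩ := binomExpansion Φ (lam y) (lam x)
    rw [map_add, add_comm (lam x) (lam y)] at e2
    obtain ⟨u, hu⟩ := d1
    obtain ⟨w, hw⟩ := d2
    refine ⟨w - u - k, ?_⟩
    have := S.ax.reg x ((derivative Φ).eval (lam y) - lam x * (w - u - k)) hxG.ne
      (by linear_combination c - e2 + e3 - hu + hw - hk)
    exact sub_eq_zero.1 this
  have hder : ∀ i, (derivative Φ).coeff i = 0 := by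
    intro i
    refine lemP3 S.ax xs (s - (i + 1 : ℕ)) _ (by omega) (fun x hx => (hxsG.mem x hx).2.ne) ?_ ?_ ?_
    · refine hxsG.pw.imp_of_mem ?_
      intro a b ha hb hab
      exact li_one (hxsG.mem a ha).2.ne (hab.mono (k' := 3) (by norm_num) (fun t ht => ht)) (by simp)
    · rw [coeff_derivative]
      have := nsmul_mem (hP (i+1)) (i + 1)
      rw [nsmul_eq_mul, mul_comm] at this
      simpa using this
    · intro x hx
      obtain ⟨hxP, hxG⟩ := hxsG.mem x hx
      apply lemV (ys.map lam)
      · rw [List.pairwise_map]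
        refine hysG.pw.imp_of_mem ?_
        intro a b ha hb hab r
        rw [← map_sub]
        apply S.ax.reg2
        rw [LinearIndependent.pair_iff]; intro α β e
        have hxG3 := hxG.mono (k' := 3) (by norm_num) (fun t ht => ht)
        have h1 : β = 0 := hxG3.coef (w1 := a) (w2 := b) (w3 := b) (by simp [ha])
          (by simp [hb]) (by simp [hb]) (a := -α) (b := α) (c := 0) (by rw [← e]; module)
        subst h1
        have := indep_one ((hysG.mem a ha).2.ne)
          (hab.mono (k' := 3) (by norm_num) (fun t ht => ht)) (by simp) (-α) α (by rw [← e]; module)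
        tauto
      · intro j hj
        rw [coeff_derivative, hP.coeff0 S.ax (j + 1) (by simp at hj; omega), zero_mul]
      · intro r hr
        obtain ⟨y, hy, rfl⟩ := List.mem_map.1 hr
        exact key x hx y hy
  ext i
  rw [coeff_zero]
  cases i with
  | zero => exact hP0
  | succ i =>
    by_cases hi : i + 1 ≤ s
    · have h1 := hder i
      rw [coeff_derivative] at h1
      have h0 := S.char (i + 1) (by omega) hi
      have h2 : ((i : R) + 1) = algebraMap K R ((i + 1 : ℕ) : K) := by
        rw [map_natCast]; push_cast; ring
      rw [h2, mul_comm, ← Algebra.smul_def] at h1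
      exact (smul_eq_zero_iff_right h0).1 h1
    · exact hP.coeff0 S.ax _ (by omega)

theorem Sys2.star (S : Sys2 lam Rt P s F H l B Gz W) {x z : V} (hx : x ∈ P (1/4))
    (hz : z ∈ P (1/8)) (hxl : Gd (K := K) 3 l x) (hzB : Gd (K := K) 3 (x :: B) z) :
    cc lam F W x z = 0 := by
  have q4 : P (1/8) ⊆ P (1/4) := S.mono _ _ (by norm_num)
  have h1 : Gd (K := K) 3 B z := hzB.mono le_rfl (by intro t ht; simp [ht])
  rw [S.cc_eval hx (q4 hz) h1 (hxl.exch (hzB.mono le_rfl (by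
    intro t ht
    rcases List.mem_cons.1 ht with rfl | h
    · simp
    · simp [S.lB h])))]
  rw [S.step4 hz h1, eval_zero]

theorem Sys2.star2 (S : Sys2 lam Rt P s F H l B Gz W) {x y : V} (hx : x ∈ P (1/16))
    (hx0 : x ≠ 0) (hy : y ∈ P (1/16)) (hyB : Gd (K := K) 4 (x :: B) y) :
    cc lam F W x y = 0 := by
  have q16 : P (1/32) ⊆ P (1/16) := S.mono _ _ (by norm_num)
  have q8 : P (1/16) ⊆ P (1/8) := S.mono _ _ (by norm_num)
  have q4 : P (1/8) ⊆ P (1/4) := S.mono _ _ (by norm_num)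
  have q2 : P (1/4) ⊆ P (1/2) := S.mono _ _ (by norm_num)
  have hBl := S.Bl
  obtain ⟨ys, hys, hysG⟩ := GdL.exists S.gen (s + 1) ((x + y) :: x :: y :: B) (by simp; omega)
  refine lemP3 S.ax ys s _ (by omega) (fun x hx => (hysG.mem x hx).2.ne) ?_
    (S.cc_mem (q2 (q4 (q8 hx))) (q2 (q4 (q8 hy)))) ?_
  · refine hysG.pw.imp_of_mem ?_
    intro a b ha hb hab
    exact li_one (hysG.mem a ha).2.ne (hab.mono (k' := 3) (by norm_num) (fun t ht => ht)) (by simp)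
  · intro y' hy'
    obtain ⟨hP, hG⟩ := hysG.mem y' hy'
    have e1 : cc lam F W (x + y) y' = 0 := by
      apply S.star (S.add _ _ _ _ _ hx hy (by norm_num)) (q8 (q16 hP))
      · exact Gd.shift (hyB.mono le_rfl (by
          intro t ht
          rcases List.mem_cons.1 ht with rfl | h
          · simp
          · simp [S.lB h]))
      · exact hG.mono (by norm_num) (by intro t ht; simp at ht ⊢; tauto)
    have e2 : cc lam F W y (x + y') = 0 := by
      apply S.star (q4 (q8 hy)) (S.add _ _ _ _ _ hx (q16 hP) (by norm_num))
      · exact hyB.mono (by norm_num) (by intro t ht; simp [S.lB ht])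
      · exact Gd.shift (hG.mono (by norm_num) (by intro t ht; simp at ht ⊢; tauto))
    have e3 : cc lam F W x y = cc lam F W x y' := by
      unfold cc at *
      rw [show y + (x + y') = x + y + y' by abel] at e2
      linear_combination e2 - e1
    rw [e3]
    apply S.cc_dvd (q2 (q4 (q8 hx))) (q2 (q4 (q8 (q16 hP))))
    exact li_one hx0 (hG.mono (k' := 3) (by norm_num) (fun t ht => ht)) (by simp)

open Classical in
theorem Sys2.addv (S : Sys2 lam Rt P s F H l B Gz W) {x y : V} (hx : x ∈ P (1/32))
    (hy : y ∈ P (1/32)) :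
    (if x + y = 0 then 0 else Ft lam F W (x + y)) =
      (if x = 0 then 0 else Ft lam F W x) + (if y = 0 then 0 else Ft lam F W y) := by
  by_cases hx0 : x = 0
  · simp [hx0]
  by_cases hy0 : y = 0
  · simp [hy0]
  have q16 : P (1/32) ⊆ P (1/16) := S.mono _ _ (by norm_num)
  have hBl := S.Bl
  obtain ⟨z, hz, hg⟩ := S.gen (x :: y :: (x + y) :: B) (by simp; omega)
  have e1 : cc lam F W y z = 0 := S.star2 (q16 hy) hy0 (q16 hz)
    (hg.mono (by norm_num) (by intro t ht; simp at ht ⊢; tauto))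
  have e2 : cc lam F W x (y + z) = 0 := S.star2 (q16 hx) hx0
    (S.add _ _ _ _ _ hy hz (by norm_num))
    (Gd.shift (hg.mono (by norm_num) (by intro t ht; simp at ht ⊢; tauto)))
  rw [if_neg hx0, if_neg hy0]
  unfold cc at *
  rw [← add_assoc] at e2
  split_ifs with h0
  · rw [h0, zero_add] at e2
    linear_combination - e1 - e2
  · have e3 : cc lam F W (x + y) z = 0 := S.star2 (S.add _ _ _ _ _ hx hy (by norm_num)) h0 (q16 hz)
      (hg.mono (by norm_num) (by intro t ht; simp at ht ⊢; tauto))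
    unfold cc at e3
    linear_combination e3 - e1 - e2

theorem core (hA : Ax lam Rt)
  (hadd : ∀ a b c x y, x ∈ P a → y ∈ P b → a + b ≤ c → x + y ∈ P c)
  (hng : ∀ a x, x ∈ P a → -x ∈ P a)
  (hmono : ∀ a b, a ≤ b → P a ⊆ P b)
  (hchar : ∀ i : ℕ, 1 ≤ i → i ≤ s → (i : K) ≠ 0)
  (gen : ∀ B : List V, B.length ≤ 10 * s + 20 → ∃ z ∈ P (1/32), Gd (K := K) 8 B z)
  (hF : ∀ x ∈ P 1, F x ∈ Rt s)
  (hH : ∀ x ∈ P (1/2), ∀ y ∈ P (1/2), LinearIndependent K ![x, y] →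
    lam x ∣ F x + F y - F (x + y) ∧ lam y ∣ F x + F y - F (x + y)) :
  ∃ (c : ℕ → R) (Fh : V → R), (∀ i : ℕ, c i ∈ Rt (s - 2 - i)) ∧
    (∀ x ∈ P (1/32), Fh x ∈ Rt s) ∧ Fh 0 = 0 ∧
    (∀ x ∈ P (1/32), ∀ y ∈ P (1/32), Fh (x + y) = Fh x + Fh y) ∧
    (∀ x, x ≠ 0 →
      Fh x = F x - lam x ^ 2 * ∑ i ∈ Finset.range (s + 1), c i * lam x ^ i) := by
  classical
  have key : ∀ x z, ∃ h : R, x ∈ P (1/2) → z ∈ P (1/2) → LinearIndependent K ![x, z] →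
      h ∈ Rt (s - 2) ∧ F x + F z - F (x + z) = lam x * lam z * h := by
    intro x z
    by_cases h : x ∈ P (1/2) ∧ z ∈ P (1/2) ∧ LinearIndependent K ![x, z]
    · obtain ⟨h1, h2, h3⟩ := h
      obtain ⟨d1, d2⟩ := hH x h1 z h2 h3
      have q : P (1/2) ⊆ P 1 := hmono _ _ (by norm_num)
      obtain ⟨h, hh⟩ := stepH hA (Submodule.sub_mem _ (Submodule.add_mem _ (hF x (q h1))
        (hF z (q h2))) (hF (x + z) (hadd _ _ _ _ _ h1 h2 (by norm_num)))) h3 d1 d2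
      exact ⟨h, fun _ _ _ => hh⟩
    · exact ⟨0, fun h1 h2 h3 => absurd ⟨h1, h2, h3⟩ h⟩
  choose H hH' using key
  have S : Sys lam Rt P s F H := ⟨hA, hadd, hng, hmono, hchar, gen, hF, hH'⟩
  obtain ⟨l, B, Gz, c, h1, h2, h3, h4, h5, h6⟩ := S.step3
  have S2 : Sys2 lam Rt P s F H l B Gz (WW s c) :=
    ⟨S, h1, h2, h4, WW_coeff0 c 0 (by norm_num), WW_coeff0 c 1 (by norm_num), h5, h6⟩
  refine ⟨c, fun x => if x = 0 then 0 else Ft lam F (WW s c) x, h3, ?_, by simp, ?_, ?_⟩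
  · intro x hx
    dsimp only
    split_ifs
    · exact Submodule.zero_mem _
    · exact Submodule.sub_mem _ (hF x (hmono _ _ (by norm_num) hx)) (h4.evl hA x)
  · intro x hx y hy
    exact S2.addv hx hy
  · intro x hx
    simp only [if_neg hx]
    rw [Ft, WW_eval]

end Polynomial.S14

namespace S14c

def lin {K : Type*} [CommRing K] {d : ℕ} (a : Fin d → K) : MvPolynomial (Fin d) K :=
  ∑ i, C (a i) * X i

theorem lin_eval {K : Type*} [CommRing K] {d : ℕ} (a n : Fin d → K) :
    eval n (lin a) = ∑ i, a i * n i := by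
  simp [lin]

theorem lin_ne {K : Type*} [CommRing K] {d : ℕ} {a : Fin d → K} (h : a ≠ 0) : lin a ≠ 0 := by
  intro h0
  apply h
  funext i
  have := lin_eval a (Pi.single i 1)
  rw [h0] at this
  simpa [Pi.single_apply] using this.symm

theorem lin_hom {K : Type*} [CommRing K] {d : ℕ} (a : Fin d → K) : (lin a).IsHomogeneous 1 := by
  refine IsHomogeneous.sum _ _ _ fun i _ => ?_
  simpa using (isHomogeneous_C (Fin d) (a i)).mul (isHomogeneous_X K i)

theorem dual {K : Type*} [Field K] {d k : ℕ} (a : Fin k → Fin d → K)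
    (h : LinearIndependent K a) :
    ∃ e : Fin k → Fin d → K, ∀ i j, ∑ l, a i l * e j l = if i = j then 1 else 0 := by
  obtain ⟨g, hg⟩ := LinearMap.exists_leftInverse_of_injective (Finsupp.linearCombination K a)
    (LinearMap.ker_eq_bot.2 h)
  refine ⟨fun j l => g (Pi.single l 1) j, fun i j => ?_⟩
  have h1 : g (a i) = Finsupp.single i 1 := by
    have := LinearMap.congr_fun hg (Finsupp.single i 1)
    simpa using this
  have h2 : a i = ∑ l, a i l • (Pi.single l 1 : Fin d → K) := by
    funext m
    simp [Pi.single_apply, Finset.sum_apply]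
  have h3 : g (a i) j = ∑ l, a i l * g (Pi.single l 1) j := by
    conv_lhs => rw [h2]
    simp [map_sum, Finsupp.finsetSum_apply]
  rw [← h3, h1, Finsupp.single_apply]

theorem lin_prime {K : Type*} [Field K] {d k : ℕ} (a : Fin k → Fin d → K)
    (h : LinearIndependent K a) : (Ideal.span (Set.range fun j => lin (a j))).IsPrime := by
  obtain ⟨e, he⟩ := dual a h
  let φ : MvPolynomial (Fin d) K →ₐ[K] MvPolynomial (Fin d) K :=
    aeval fun i => X i - ∑ j, C (e j i) * lin (a j)
  have h1 : ∀ j, φ (lin (a j)) = 0 := by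
    intro j
    have : φ (lin (a j)) = lin (a j) - ∑ i, ∑ l, C (a j i) * (C (e l i) * lin (a l)) := by
      simp only [lin, map_sum, map_mul, φ, aeval_X, algHom_C, algebraMap_eq, mul_sub,
        Finset.sum_sub_distrib, Finset.mul_sum]
    rw [this, Finset.sum_comm]
    have : ∀ l, ∑ i, C (a j i) * (C (e l i) * lin (a l)) = C (if j = l then 1 else 0) * lin (a l) := by
      intro l
      rw [← he j l, map_sum, Finset.sum_mul]
      refine Finset.sum_congr rfl fun i _ => ?_
      rw [map_mul, mul_assoc]
    simp only [this]
    simp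
  set I := Ideal.span (Set.range fun j => lin (a j)) with hI
  have h2 : ∀ f, Ideal.Quotient.mk I (φ f) = Ideal.Quotient.mk I f := by
    intro f
    have : (Ideal.Quotient.mkₐ K I).comp φ = Ideal.Quotient.mkₐ K I := by
      apply MvPolynomial.algHom_ext
      intro i
      simp only [AlgHom.comp_apply, φ, aeval_X, Ideal.Quotient.mkₐ_eq_mk]
      rw [Ideal.Quotient.eq, sub_sub_cancel_left]
      refine neg_mem (Ideal.sum_mem _ fun j _ => Ideal.mul_mem_left _ _ ?_)
      exact Ideal.subset_span ⟨j, rfl⟩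
    exact DFunLike.congr_fun this f
  have h3 : I = RingHom.ker φ := by
    apply le_antisymm
    · rw [hI, Ideal.span_le]
      rintro _ ⟨j, rfl⟩
      exact h1 j
    · intro f hf
      rw [← Ideal.Quotient.eq_zero_iff_mem, ← h2, (hf : φ f = 0), map_zero]
  rw [h3]
  exact RingHom.ker_isPrime _

theorem quad_eval {p d : ℕ} (A : Matrix (Fin d) (Fin d) (ZMod p)) (n : Fin d → ZMod p) :
    eval n (quadPoly p d A) = Matrix.toBilin' A n n := by
  simp only [quadPoly, map_sum, map_mul, eval_C, eval_X, Matrix.toBilin'_apply]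
  refine Finset.sum_congr rfl fun i _ => Finset.sum_congr rfl fun j _ => by ring

theorem quad_hom {p d : ℕ} (A : Matrix (Fin d) (Fin d) (ZMod p)) :
    (quadPoly p d A).IsHomogeneous 2 := by
  refine IsHomogeneous.sum _ _ _ fun i _ => IsHomogeneous.sum _ _ _ fun j _ => ?_
  simpa using (isHomogeneous_C (Fin d) (A i j)).mul
    ((isHomogeneous_X (ZMod p) i).mul (isHomogeneous_X (ZMod p) j))

theorem quad_notin {p d k : ℕ} [Fact p.Prime] (hp : 3 ≤ p) (hd : 9 ≤ d) (hk : k ≤ 2)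
    (A : Matrix (Fin d) (Fin d) (ZMod p)) (hA : A.IsSymm) (hdet : A.det ≠ 0)
    (a : Fin k → Fin d → ZMod p) :
    quadPoly p d A ∉ Ideal.span (Set.range fun j => lin (a j)) := by
  intro hq
  let m : (Fin d → ZMod p) →ₗ[ZMod p] (Fin k → ZMod p) := Matrix.mulVecLin (Matrix.of a)
  let W := LinearMap.ker m
  let B := Matrix.toBilin' A
  have hW : ∀ n ∈ W, B n n = 0 := by
    intro n hn
    rw [← quad_eval]
    have : Ideal.span (Set.range fun j => lin (a j)) ≤ RingHom.ker (eval n) := by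
      rw [Ideal.span_le]
      rintro _ ⟨j, rfl⟩
      change eval n (lin (a j)) = 0
      rw [lin_eval]
      exact congrFun (LinearMap.mem_ker.1 hn) j
    exact this hq
  have hsym : B.IsSymm := by
    constructor
    intro x y
    simp only [B, Matrix.toBilin'_apply]
    rw [Finset.sum_comm]
    refine Finset.sum_congr rfl fun i _ => Finset.sum_congr rfl fun j _ => ?_
    rw [hA.apply]
    ring
  have h2 : (2 : ZMod p) ≠ 0 := by
    intro h
    have : ((2 : ℕ) : ZMod p) = 0 := by exact_mod_cast h
    rw [ZMod.natCast_eq_zero_iff] at this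
    have := Nat.le_of_dvd (by norm_num) this
    omega
  have hWo : W ≤ LinearMap.BilinForm.orthogonal B W := by
    intro y hy
    rw [LinearMap.BilinForm.mem_orthogonal_iff]
    intro x hx
    have e := hW _ (W.add_mem hx hy)
    have e2 : B y x = B x y := (hsym.eq x y).symm
    rw [map_add, map_add, LinearMap.add_apply, LinearMap.add_apply, hW x hx, hW y hy, e2] at e
    have : 2 * B x y = 0 := by linear_combination e
    exact (mul_eq_zero.1 this).resolve_left h2
  have hnd : B.Nondegenerate := LinearMap.BilinForm.nondegenerate_toBilin'_iff_det_ne_zero.2 hdet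
  have f1 := LinearMap.BilinForm.finrank_orthogonal hnd W
  have f2 := Submodule.finrank_mono hWo
  have f3 := LinearMap.finrank_range_add_finrank_ker m
  have f4 := Submodule.finrank_le (LinearMap.range m)
  simp only [Module.finrank_fin_fun] at f1 f3 f4
  change _ + Module.finrank _ W = _ at f3
  omega

end S14c

namespace S14c

abbrev QR (p d : ℕ) (A : Matrix (Fin d) (Fin d) (ZMod p)) : Type :=
  MvPolynomial (Fin d) (ZMod p) ⧸ Ideal.span {quadPoly p d A}

def qmk (p d : ℕ) (A : Matrix (Fin d) (Fin d) (ZMod p)) :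
    MvPolynomial (Fin d) (ZMod p) →ₐ[ZMod p] QR p d A :=
  Ideal.Quotient.mkₐ (ZMod p) (Ideal.span {quadPoly p d A})

theorem qmk_surj {p d : ℕ} (A : Matrix (Fin d) (Fin d) (ZMod p)) :
    Function.Surjective (qmk p d A) := Ideal.Quotient.mkₐ_surjective _ _

theorem qmk_zero {p d : ℕ} (A : Matrix (Fin d) (Fin d) (ZMod p))
    (f : MvPolynomial (Fin d) (ZMod p)) : qmk p d A f = 0 ↔ quadPoly p d A ∣ f := by
  rw [← Ideal.mem_span_singleton]
  exact Ideal.Quotient.eq_zero_iff_mem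

theorem lx_lin {p d : ℕ} (A : Matrix (Fin d) (Fin d) (ZMod p)) (x : Fin d → ZMod p) :
    lx p d A x = lin (A.mulVec x) := rfl

def lxl (p d : ℕ) (A : Matrix (Fin d) (Fin d) (ZMod p)) :
    (Fin d → ZMod p) →ₗ[ZMod p] MvPolynomial (Fin d) (ZMod p) where
  toFun := lx p d A
  map_add' x y := by
    simp only [lx_lin, Matrix.mulVec_add, lin, Pi.add_apply, map_add, add_mul,
      Finset.sum_add_distrib]
  map_smul' c x := by
    simp only [lx_lin, Matrix.mulVec_smul, lin, Pi.smul_apply, smul_eq_mul, map_mul, mul_assoc,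
      Finset.smul_sum, RingHom.id_apply, smul_eq_C_mul]

def lam (p d : ℕ) (A : Matrix (Fin d) (Fin d) (ZMod p)) :
    (Fin d → ZMod p) →ₗ[ZMod p] QR p d A :=
  (qmk p d A).toLinearMap ∘ₗ lxl p d A

theorem lam_apply {p d : ℕ} (A : Matrix (Fin d) (Fin d) (ZMod p)) (x : Fin d → ZMod p) :
    lam p d A x = qmk p d A (lx p d A x) := rfl

def Rt (p d : ℕ) (A : Matrix (Fin d) (Fin d) (ZMod p)) (t : ℤ) :
    Submodule (ZMod p) (QR p d A) :=
  if 0 ≤ t then (homogeneousSubmodule (Fin d) (ZMod p) t.toNat).map (qmk p d A).toLinearMap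
  else ⊥

theorem Rt_nat {p d : ℕ} (A : Matrix (Fin d) (Fin d) (ZMod p)) (t : ℕ) (r : QR p d A) :
    r ∈ Rt p d A t ↔ ∃ f, f.IsHomogeneous t ∧ qmk p d A f = r := by
  unfold Rt
  rw [if_pos (by omega)]
  simp [Submodule.mem_map, mem_homogeneousSubmodule]

theorem Rt_neg {p d : ℕ} (A : Matrix (Fin d) (Fin d) (ZMod p)) (t : ℤ) (ht : t < 0)
    (r : QR p d A) (h : r ∈ Rt p d A t) : r = 0 := by
  unfold Rt at h
  rw [if_neg (by omega)] at h
  simpa using h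

theorem li2 {p d : ℕ} [Fact p.Prime] (A : Matrix (Fin d) (Fin d) (ZMod p)) (hdet : A.det ≠ 0)
    {k : ℕ} (x : Fin k → Fin d → ZMod p)
    (h : LinearIndependent (ZMod p) x) : LinearIndependent (ZMod p) fun j => A.mulVec (x j) := by
  refine h.map' (Matrix.mulVecLin A) ?_
  rw [LinearMap.ker_eq_bot]
  exact Matrix.mulVec_injective_of_isUnit ((Matrix.isUnit_iff_isUnit_det A).2 hdet.isUnit)

theorem comp_mul {K : Type*} [Field K] {d m : ℕ} (l g : MvPolynomial (Fin d) K)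
    (hl : l.IsHomogeneous m) (n : ℕ) :
    homogeneousComponent (n + m) (l * g) = l * homogeneousComponent n g := by
  have h : l * g = ∑ i ∈ Finset.range (g.totalDegree + 1), l * homogeneousComponent i g := by
    conv_lhs => rw [← sum_homogeneousComponent g, Finset.mul_sum]
  rw [h, map_sum]
  have : ∀ i ∈ Finset.range (g.totalDegree + 1),
      homogeneousComponent (n + m) (l * homogeneousComponent i g) =
      if i = n then l * homogeneousComponent n g else 0 := by
    intro i _
    have := hl.mul (homogeneousComponent_isHomogeneous i g)
    rw [homogeneousComponent_of_mem ((mem_homogeneousSubmodule _ _).2 this)]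
    by_cases hi : i = n
    · subst hi
      rw [if_pos rfl, if_pos (by omega)]
    · rw [if_neg hi, if_neg (by omega)]
  rw [Finset.sum_congr rfl this, Finset.sum_ite_eq']
  split_ifs with hh
  · rfl
  · rw [homogeneousComponent_eq_zero _ _ (by simpa using hh), mul_zero]

theorem comp_mul_lt {K : Type*} [Field K] {d m : ℕ} (l g : MvPolynomial (Fin d) K)
    (hl : l.IsHomogeneous m) (n : ℕ) (hn : n < m) :
    homogeneousComponent n (l * g) = 0 := by
  have h : l * g = ∑ i ∈ Finset.range (g.totalDegree + 1), l * homogeneousComponent i g := by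
    conv_lhs => rw [← sum_homogeneousComponent g, Finset.mul_sum]
  rw [h, map_sum]
  refine Finset.sum_eq_zero fun i _ => ?_
  have := hl.mul (homogeneousComponent_isHomogeneous i g)
  rw [homogeneousComponent_of_mem ((mem_homogeneousSubmodule _ _).2 this), if_neg (by omega)]

section
variable {p d : ℕ} [Fact p.Prime] (hp : 3 ≤ p) (hd : 9 ≤ d)
    (A : Matrix (Fin d) (Fin d) (ZMod p)) (hA : A.IsSymm) (hdet : A.det ≠ 0)
include hp hd hA hdet

theorem regS (x : Fin d → ZMod p) (f : MvPolynomial (Fin d) (ZMod p)) (hx : x ≠ 0)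
    (h : quadPoly p d A ∣ lx p d A x * f) : quadPoly p d A ∣ f := by
  have hli : LinearIndependent (ZMod p) ![x] := by
    rw [linearIndependent_unique_iff]
    simpa using hx
  have hli2 := li2 A hdet _ hli
  have hpr := lin_prime _ hli2
  have hnq := quad_notin hp hd (by norm_num) A hA hdet fun j => A.mulVec (![x] j)
  have hr : (Set.range fun j => lin (A.mulVec (![x] j))) = {lx p d A x} := by
    ext t
    simp [lx_lin]
  rw [hr] at hpr hnq
  obtain ⟨a, ha⟩ := h
  have : quadPoly p d A * a ∈ Ideal.span {lx p d A x} := by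
    rw [← ha]
    exact Ideal.mul_mem_right _ _ (Ideal.mem_span_singleton_self _)
  have := (hpr.mem_or_mem this).resolve_left hnq
  obtain ⟨b, rfl⟩ := Ideal.mem_span_singleton.1 this
  refine ⟨b, ?_⟩
  have h0 : lx p d A x ≠ 0 := by
    rw [lx_lin]
    exact lin_ne (hli2.ne_zero 0)
  apply mul_left_cancel₀ h0
  rw [ha]
  ring

theorem reg2S (x y : Fin d → ZMod p) (f a b : MvPolynomial (Fin d) (ZMod p))
    (hli : LinearIndependent (ZMod p) ![x, y])
    (h : lx p d A x * f = quadPoly p d A * a + lx p d A y * b) :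
    ∃ a' b', f = quadPoly p d A * a' + lx p d A y * b' := by
  have hli2 := li2 A hdet _ hli
  have hpr := lin_prime _ hli2
  have hnq := quad_notin hp hd (by norm_num) A hA hdet fun j => A.mulVec (![x, y] j)
  have hr : (Set.range fun j => lin (A.mulVec (![x, y] j))) = {lx p d A x, lx p d A y} := by
    ext t
    simp [lx_lin, eq_comm, Fin.exists_fin_two]
  rw [hr] at hpr hnq
  have : quadPoly p d A * a ∈ Ideal.span {lx p d A x, lx p d A y} := by
    rw [Ideal.mem_span_pair]
    exact ⟨f, -b, by linear_combination h⟩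
  have := (hpr.mem_or_mem this).resolve_left hnq
  rw [Ideal.mem_span_pair] at this
  obtain ⟨a1, a2, ha⟩ := this
  have hy : y ≠ 0 := by simpa using hli.ne_zero 1
  have hliy : LinearIndependent (ZMod p) ![y] := by
    rw [linearIndependent_unique_iff]
    simpa using hy
  have hpr1 := lin_prime _ (li2 A hdet _ hliy)
  have hr1 : (Set.range fun j => lin (A.mulVec (![y] j))) = {lx p d A y} := by
    ext t
    simp [lx_lin]
  rw [hr1] at hpr1
  have hm : lx p d A x * (f - quadPoly p d A * a1) ∈ Ideal.span {lx p d A y} := by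
    rw [Ideal.mem_span_singleton]
    exact ⟨quadPoly p d A * a2 + b, by linear_combination h - quadPoly p d A * ha⟩
  have hxn : lx p d A x ∉ Ideal.span {lx p d A y} := by
    obtain ⟨e, he⟩ := dual _ hli2
    intro hc
    obtain ⟨c, hc⟩ := Ideal.mem_span_singleton.1 hc
    have h1 := he 0 0
    have h2 := he 1 0
    have := congrArg (eval (e 0)) hc
    rw [map_mul, lx_lin, lx_lin, lin_eval, lin_eval] at this
    simp at h1 h2
    rw [h1, h2] at this
    simp at this
  obtain ⟨b', hb'⟩ := Ideal.mem_span_singleton.1 ((hpr1.mem_or_mem hm).resolve_left hxn)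
  exact ⟨a1, b', by linear_combination hb'⟩

theorem degS (x : Fin d → ZMod p) (g f : MvPolynomial (Fin d) (ZMod p)) (hx : x ≠ 0)
    (t : ℕ) (hf : f.IsHomogeneous t) (h : quadPoly p d A ∣ lx p d A x * g - f) :
    (t = 0 → quadPoly p d A ∣ g) ∧
    ∀ t', t = t' + 1 → quadPoly p d A ∣ g - homogeneousComponent t' g := by
  have key : ∀ i, quadPoly p d A ∣ homogeneousComponent (i + 1) (lx p d A x * g - f) := by
    intro i
    obtain ⟨a, ha⟩ := h
    rw [ha]
    rcases lt_or_ge (i + 1) 2 with h1 | h1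
    · rw [comp_mul_lt _ _ (quad_hom A) _ h1]
      exact dvd_zero _
    · obtain ⟨j, hj⟩ := Nat.exists_eq_add_of_le' h1
      rw [hj, comp_mul _ _ (quad_hom A)]
      exact dvd_mul_right _ _
  have key2 : ∀ i, i + 1 ≠ t → quadPoly p d A ∣ homogeneousComponent i g := by
    intro i hi
    have := key i
    rw [map_sub, comp_mul _ _ (show (lx p d A x).IsHomogeneous 1 from lin_hom _),
      homogeneousComponent_of_mem ((mem_homogeneousSubmodule _ _).2 hf), if_neg hi, sub_zero] at this
    exact regS hp hd A hA hdet x _ hx this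
  constructor
  · intro ht
    rw [← sum_homogeneousComponent g]
    exact Finset.dvd_sum fun i _ => key2 i (by omega)
  · intro t' ht
    have : g - homogeneousComponent t' g =
        ∑ i ∈ Finset.range (g.totalDegree + 1), if i = t' then 0 else homogeneousComponent i g := by
      conv_lhs => enter [1]; rw [← sum_homogeneousComponent g]
      have e : homogeneousComponent t' g = ∑ i ∈ Finset.range (g.totalDegree + 1),
          if i = t' then homogeneousComponent t' g else 0 := by
        rw [Finset.sum_ite_eq']
        split_ifs with hh
        · rfl
        · exact homogeneousComponent_eq_zero _ _ (by simpa using hh)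
      conv_lhs => enter [2]; rw [e]
      rw [← Finset.sum_sub_distrib]
      refine Finset.sum_congr rfl fun i _ => ?_
      split_ifs with hi
      · rw [hi, sub_self]
      · rw [sub_zero]
    rw [this]
    refine Finset.dvd_sum fun i _ => ?_
    split_ifs with hi
    · exact dvd_zero _
    · exact key2 i (by omega)

theorem axQ : Polynomial.S14.Ax (lam p d A) (Rt p d A) where
  mul := by
    intro x f t hf
    rcases lt_or_ge t 0 with ht | ht
    · rw [Rt_neg A t ht f hf, mul_zero]
      exact Submodule.zero_mem _
    · lift t to ℕ using ht
      obtain ⟨g, hg, rfl⟩ := (Rt_nat A t f).1 hf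
      refine (Rt_nat A (t + 1) _).2 ⟨lx p d A x * g, ?_, ?_⟩
      · rw [add_comm]
        exact (lin_hom _).mul hg
      · rw [map_mul, lam_apply]
  neg := fun t f ht hf => Rt_neg A t ht f hf
  reg := by
    intro x f hx h
    obtain ⟨f, rfl⟩ := qmk_surj A f
    rw [lam_apply, ← map_mul, qmk_zero] at h
    rw [qmk_zero]
    exact regS hp hd A hA hdet x f hx h
  reg2 := by
    intro x y f hli h
    obtain ⟨f, rfl⟩ := qmk_surj A f
    obtain ⟨b, hb⟩ := h
    obtain ⟨b, rfl⟩ := qmk_surj A b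
    rw [lam_apply, lam_apply, ← map_mul, ← map_mul, ← sub_eq_zero, ← map_sub, qmk_zero] at hb
    obtain ⟨a, ha⟩ := hb
    obtain ⟨a', b', h'⟩ := reg2S hp hd A hA hdet x y f a b hli (by linear_combination ha)
    refine ⟨qmk p d A b', ?_⟩
    rw [lam_apply, ← map_mul, ← sub_eq_zero, ← map_sub, qmk_zero]
    exact ⟨a', by linear_combination h'⟩
  deg := by
    intro x g t hx h
    obtain ⟨g, rfl⟩ := qmk_surj A g
    rw [lam_apply, ← map_mul] at h
    rcases lt_or_ge t 0 with ht | ht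
    · have := Rt_neg A t ht _ h
      rw [qmk_zero] at this
      rw [(qmk_zero A g).2 (regS hp hd A hA hdet x g hx this)]
      exact Submodule.zero_mem _
    · lift t to ℕ using ht
      obtain ⟨f, hf, h⟩ := (Rt_nat A t _).1 h
      rw [eq_comm, ← sub_eq_zero, ← map_sub, qmk_zero] at h
      obtain ⟨d1, d2⟩ := degS hp hd A hA hdet x g f hx t hf h
      rcases t with _ | t
      · rw [(qmk_zero A g).2 (d1 rfl)]
        exact Submodule.zero_mem _
      · have e := d2 t rfl
        rw [← qmk_zero, map_sub, sub_eq_zero] at e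
        have := (Rt_nat A t (qmk p d A g)).2 ⟨_, homogeneousComponent_isHomogeneous t g, e.symm⟩
        convert this using 2
        push_cast
        ring

end
end S14c

namespace S14c

theorem gap_add {p d D : ℕ} {v : Fin D → Fin d → ZMod p} {L : Fin D → ℝ} (hL : ∀ i, 0 < L i)
    (a b c : ℝ) (x y : Fin d → ZMod p) (hx : x ∈ gap p d D v L a) (hy : y ∈ gap p d D v L b)
    (h : a + b ≤ c) : x + y ∈ gap p d D v L c := by
  obtain ⟨l, hl, rfl⟩ := hx
  obtain ⟨m, hm, rfl⟩ := hy
  refine ⟨l + m, fun i => ?_, ?_⟩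
  · have h1 := hl i
    have h2 := hm i
    have h3 : (a + b) * L i ≤ c * L i := mul_le_mul_of_nonneg_right h (hL i).le
    simp only [Pi.add_apply, Int.cast_add]
    constructor <;> linarith [h1.1, h1.2, h2.1, h2.2]
  · simp [add_smul, Finset.sum_add_distrib]

theorem gap_neg {p d D : ℕ} {v : Fin D → Fin d → ZMod p} {L : Fin D → ℝ}
    (a : ℝ) (x : Fin d → ZMod p) (hx : x ∈ gap p d D v L a) : -x ∈ gap p d D v L a := by
  obtain ⟨l, hl, rfl⟩ := hx
  refine ⟨-l, fun i => ?_, ?_⟩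
  · have h1 := hl i
    simp only [Pi.neg_apply, Int.cast_neg]
    constructor <;> linarith [h1.1, h1.2]
  · simp [Finset.sum_neg_distrib]

theorem gap_mono {p d D : ℕ} {v : Fin D → Fin d → ZMod p} {L : Fin D → ℝ} (hL : ∀ i, 0 < L i)
    (a b : ℝ) (h : a ≤ b) : gap p d D v L a ⊆ gap p d D v L b := by
  rintro _ ⟨l, hl, rfl⟩
  refine ⟨l, fun i => ?_, rfl⟩
  have h1 := hl i
  have h3 : a * L i ≤ b * L i := mul_le_mul_of_nonneg_right h (hL i).le
  constructor <;> linarith [h1.1, h1.2]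

theorem gap_count {p d D : ℕ} [Fact p.Prime] {v : Fin D → Fin d → ZMod p} {L : Fin D → ℝ}
    (hL : ∀ i, 0 < L i) :
    (gap p d D v L 1).ncard ≤ (gap p d D v L (1/32)).ncard * 64 ^ D := by
  classical
  have key : ∀ x, ∃ l : Fin D → ℤ, x ∈ gap p d D v L 1 →
      (∀ i, -(1 * L i) < (l i : ℝ) ∧ (l i : ℝ) < 1 * L i) ∧ x = ∑ i, l i • v i := by
    intro x
    by_cases h : x ∈ gap p d D v L 1
    · obtain ⟨l, hl⟩ := h
      exact ⟨l, fun _ => hl⟩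
    · exact ⟨0, fun h' => absurd h' h⟩
  choose l hl using key
  rw [Set.ncard_eq_toFinset_card', Set.ncard_eq_toFinset_card']
  have hc : (Fintype.piFinset fun _ : Fin D => Finset.Icc (-32 : ℤ) 31).card = 64 ^ D := by
    simp
  rw [← hc]
  refine Finset.card_le_mul_card_image_of_maps_to (f := fun x i => ⌊32 * (l x i : ℝ) / L i⌋) ?_ _ ?_
  · intro x hx
    rw [Set.mem_toFinset] at hx
    rw [Fintype.mem_piFinset]
    intro i
    obtain ⟨h1, h2⟩ := (hl x hx).1 i
    rw [Finset.mem_Icc]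
    constructor
    · rw [Int.le_floor, le_div_iff₀ (hL i)]
      push_cast
      linarith
    · rw [← Int.lt_add_one_iff, Int.floor_lt, div_lt_iff₀ (hL i)]
      push_cast
      linarith
  · intro b _
    rcases Finset.eq_empty_or_nonempty {x ∈ (gap p d D v L 1).toFinset |
      (fun i => ⌊32 * (l x i : ℝ) / L i⌋) = b} with he | ⟨x0, hx0⟩
    · rw [he]
      simp
    · refine Finset.card_le_card_of_injOn (fun x => x - x0) ?_ ?_
      · intro x hx
        simp only [Finset.coe_filter, Set.mem_ofPred_eq, Finset.mem_filter, Set.mem_toFinset] at hx hx0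
        simp only [Set.coe_toFinset]
        have e1 := hl x hx.1
        have e2 := hl x0 hx0.1
        refine ⟨l x - l x0, fun i => ?_, ?_⟩
        · have e : ⌊32 * (l x i : ℝ) / L i⌋ = ⌊32 * (l x0 i : ℝ) / L i⌋ :=
            (congrFun hx.2 i).trans (congrFun hx0.2 i).symm
          have := Int.abs_sub_lt_one_of_floor_eq_floor e
          rw [← sub_div, abs_lt] at this
          obtain ⟨t1, t2⟩ := this
          rw [div_lt_iff₀ (hL i)] at t2
          rw [lt_div_iff₀ (hL i)] at t1
          simp only [Pi.sub_apply, Int.cast_sub]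
          constructor <;> linarith
        · conv_lhs => rw [e1.2, e2.2]
          simp [sub_smul, Finset.sum_sub_distrib]
      · intro x _ y _ h
        exact sub_left_injective h

theorem gap_gen {p d D m : ℕ} [Fact p.Prime] {v : Fin D → Fin d → ZMod p} {L : Fin D → ℝ}
    (hL : ∀ i, 0 < L i) (δ : ℝ) (hδ : 0 < δ) (hd : 9 ≤ d)
    (hp : (2:ℝ) ^ m * 64 ^ D / δ ≤ p)
    (hc : δ * (p : ℝ) ^ d < ((gap p d D v L 1).ncard : ℝ))
    (B : List (Fin d → ZMod p)) (hB : B.length ≤ m) :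
    ∃ z ∈ gap p d D v L (1/32), Polynomial.S14.Gd (K := ZMod p) 8 B z := by
  classical
  by_contra hcon
  push Not at hcon
  have hsub : (gap p d D v L (1/32)).toFinset ⊆
      (B.toFinset.powerset.filter fun T => T.card ≤ 8).biUnion
        fun T => (Submodule.span (ZMod p) (T : Set (Fin d → ZMod p)) : Set (Fin d → ZMod p)).toFinset := by
    intro z hz
    rw [Set.mem_toFinset] at hz
    have := hcon z hz
    unfold Polynomial.S14.Gd at this
    push Not at this
    obtain ⟨T, h1, h2, h3⟩ := this
    simp only [Finset.mem_biUnion, Finset.mem_filter, Finset.mem_powerset, Set.mem_toFinset]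
    exact ⟨T, ⟨fun t ht => by simpa using h1 t ht, h2⟩, h3⟩
  have hp0 : 0 < p := (Fact.out : p.Prime).pos
  have h1 : (gap p d D v L (1/32)).ncard ≤ 2 ^ m * p ^ 8 := by
    rw [Set.ncard_eq_toFinset_card']
    refine (Finset.card_le_card hsub).trans ?_
    refine (Finset.card_biUnion_le_card_mul _ _ (p ^ 8) ?_).trans ?_
    · intro T hT
      rw [Finset.mem_filter] at hT
      rw [Set.toFinset_card]
      have e := Module.card_eq_pow_finrank (K := ZMod p)
        (V := Submodule.span (ZMod p) (T : Set (Fin d → ZMod p)))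
      rw [ZMod.card] at e
      refine (le_of_eq ?_).trans (e.le.trans (Nat.pow_le_pow_right hp0
        ((finrank_span_finset_le_card T).trans hT.2)))
      exact Fintype.card_congr (Equiv.refl _)
    · refine Nat.mul_le_mul_right _ ?_
      refine (Finset.card_filter_le _ _).trans ?_
      rw [Finset.card_powerset]
      exact Nat.pow_le_pow_right (by norm_num) ((List.toFinset_card_le B).trans hB)
  have h2 := (gap_count (v := v) hL).trans (Nat.mul_le_mul_right _ h1)
  have h3 : ((gap p d D v L 1).ncard : ℝ) ≤ 2 ^ m * p ^ 8 * 64 ^ D := by exact_mod_cast h2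
  have hp1 : (1 : ℝ) ≤ p := by exact_mod_cast hp0
  have h4 : (p : ℝ) ^ 9 ≤ (p : ℝ) ^ d := pow_le_pow_right₀ hp1 hd
  rw [div_le_iff₀ hδ] at hp
  have h5 : (2:ℝ) ^ m * 64 ^ D * p ^ 8 ≤ p * δ * p ^ 8 :=
    mul_le_mul_of_nonneg_right hp (by positivity)
  have h6 := mul_le_mul_of_nonneg_left h4 hδ.le
  nlinarith

theorem lin_eq_lx {p d : ℕ} (A : Matrix (Fin d) (Fin d) (ZMod p)) (hA : A.IsSymm)
    (x : Fin d → ZMod p) : linPoly p d A x = lx p d A x := by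
  unfold linPoly lx
  refine Finset.sum_congr rfl fun j _ => ?_
  congr 2
  refine Finset.sum_congr rfl fun i _ => ?_
  rw [hA.apply, mul_comm]

theorem JM_dvd {p d : ℕ} (A : Matrix (Fin d) (Fin d) (ZMod p)) (hA : A.IsSymm)
    (x : Fin d → ZMod p) (f : MvPolynomial (Fin d) (ZMod p))
    (h : f ∈ JM p d A (Submodule.span (ZMod p) {x} : Set (Fin d → ZMod p))) :
    lam p d A x ∣ qmk p d A f := by
  have : JM p d A (Submodule.span (ZMod p) {x} : Set (Fin d → ZMod p)) ≤
      (Ideal.span {lam p d A x}).comap (qmk p d A) := by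
    unfold JM
    rw [Ideal.span_le]
    rintro g (hg | ⟨y, hy, rfl⟩)
    · rw [Set.mem_singleton_iff] at hg
      subst hg
      change qmk p d A _ ∈ Ideal.span {lam p d A x}
      rw [(qmk_zero A _).2 dvd_rfl]
      exact Ideal.zero_mem _
    · change qmk p d A _ ∈ Ideal.span {lam p d A x}
      obtain ⟨c, rfl⟩ := Submodule.mem_span_singleton.1 hy
      have e : lx p d A (c • x) = C c * lx p d A x := by
        rw [← smul_eq_C_mul]
        exact (lxl p d A).map_smul c x
      rw [lin_eq_lx A hA, e, map_mul, ← lam_apply, Ideal.mem_span_singleton]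
      exact dvd_mul_left _ _
  exact Ideal.mem_span_singleton.1 (this h)

theorem gap_v {p d D : ℕ} {v : Fin D → Fin d → ZMod p} {L : Fin D → ℝ} (hL : ∀ i, 0 < L i)
    (c : ℝ) (hc : 0 < c) (l : Fin D → ℤ) (hl : ∀ i, -(c * L i) < (l i : ℝ) ∧ (l i : ℝ) < c * L i)
    (i : Fin D) (hi : l i ≠ 0) : v i ∈ gap p d D v L c := by
  refine ⟨Pi.single i 1, fun j => ?_, ?_⟩
  · have hj := mul_pos hc (hL j)
    by_cases h : j = i
    · subst h
      simp only [Pi.single_eq_same, Int.cast_one]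
      refine ⟨by linarith, ?_⟩
      have h1 : (1 : ℝ) ≤ |(l j : ℝ)| := by exact_mod_cast Int.one_le_abs hi
      exact h1.trans_lt (abs_lt.2 (hl j))
    · simp only [Pi.single_eq_of_ne h, Int.cast_zero]
      constructor <;> linarith
  · simp [Pi.single_apply, ite_smul]

theorem add_box {p d D : ℕ} {v : Fin D → Fin d → ZMod p} {L : Fin D → ℝ} (hL : ∀ i, 0 < L i)
    (c : ℝ) (hc : 0 < c) {R : Type*} [AddCommGroup R] (f : (Fin d → ZMod p) → R) (h0 : f 0 = 0)
    (hf : ∀ x ∈ gap p d D v L c, ∀ y ∈ gap p d D v L c, f (x + y) = f x + f y) (n : ℕ) :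
    ∀ l : Fin D → ℤ, (∀ i, -(c * L i) < (l i : ℝ) ∧ (l i : ℝ) < c * L i) →
      ∑ i, (l i).natAbs = n → f (∑ i, l i • v i) = ∑ i, l i • f (v i) := by
  classical
  induction n with
  | zero =>
    intro l hl hn
    have : ∀ i, l i = 0 := by
      intro i
      have := (Finset.sum_eq_zero_iff.1 hn) i (Finset.mem_univ i)
      omega
    simp [this, h0]
  | succ n ih =>
    intro l hl hn
    obtain ⟨i, hi⟩ : ∃ i, l i ≠ 0 := by
      by_contra hcon
      push Not at hcon
      simp [hcon] at hn
    have hv := gap_v (v := v) hL c hc l hl i hi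
    obtain ⟨e, he, hle⟩ : ∃ e : ℤ, (e = 1 ∨ e = -1) ∧ (l i - e).natAbs + 1 = (l i).natAbs := by
      rcases lt_or_gt_of_ne hi with h | h
      · exact ⟨-1, Or.inr rfl, by omega⟩
      · exact ⟨1, Or.inl rfl, by omega⟩
    have hev : e • v i ∈ gap p d D v L c ∧ f (e • v i) = e • f (v i) := by
      rcases he with rfl | rfl
      · simpa using hv
      · have hn := gap_neg c _ hv
        have := hf _ hv _ hn
        rw [add_neg_cancel, h0] at this
        simp only [neg_smul, one_smul]
        exact ⟨hn, (neg_eq_of_add_eq_zero_right this.symm).symm⟩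
    let l' := Function.update l i (l i - e)
    have hl' : ∀ j, -(c * L j) < (l' j : ℝ) ∧ (l' j : ℝ) < c * L j := by
      intro j
      by_cases h : j = i
      · subst h
        simp only [l', Function.update_self]
        rw [← abs_lt]
        refine lt_of_le_of_lt ?_ (abs_lt.2 (hl j))
        have : |l j - e| ≤ |l j| := by
          rw [Int.abs_eq_natAbs, Int.abs_eq_natAbs]
          omega
        exact_mod_cast this
      · simp only [l', Function.update_of_ne h]
        exact hl j
    have hn' : ∑ j, (l' j).natAbs = n := by
      rw [← Finset.add_sum_erase _ _ (Finset.mem_univ i)] at hn ⊢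
      have : ∑ j ∈ Finset.univ.erase i, (l' j).natAbs = ∑ j ∈ Finset.univ.erase i, (l j).natAbs := by
        refine Finset.sum_congr rfl fun j hj => ?_
        simp only [l', Function.update_of_ne (Finset.ne_of_mem_erase hj)]
      rw [this]
      simp only [l', Function.update_self]
      omega
    have s1 : ∑ j, l j • v j = (∑ j, l' j • v j) + e • v i := by
      rw [← Finset.add_sum_erase _ _ (Finset.mem_univ i),
        ← Finset.add_sum_erase _ (fun j => l' j • v j) (Finset.mem_univ i)]
      have : ∑ j ∈ Finset.univ.erase i, l' j • v j =
          ∑ j ∈ Finset.univ.erase i, l j • v j := by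
        refine Finset.sum_congr rfl fun j hj => ?_
        simp only [l', Function.update_of_ne (Finset.ne_of_mem_erase hj)]
      rw [this]
      simp only [l', Function.update_self, sub_smul]
      abel
    have s2 : ∑ j, l j • f (v j) = (∑ j, l' j • f (v j)) + e • f (v i) := by
      rw [← Finset.add_sum_erase _ _ (Finset.mem_univ i),
        ← Finset.add_sum_erase _ (fun j => l' j • f (v j)) (Finset.mem_univ i)]
      have : ∑ j ∈ Finset.univ.erase i, l' j • f (v j) =
          ∑ j ∈ Finset.univ.erase i, l j • f (v j) := by
        refine Finset.sum_congr rfl fun j hj => ?_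
        simp only [l', Function.update_of_ne (Finset.ne_of_mem_erase hj)]
      rw [this]
      simp only [l', Function.update_self, sub_smul]
      abel
    rw [s1, s2, hf _ ⟨l', hl', rfl⟩ _ hev.1, ih l' hl' hn', hev.2]

end S14c

/-- If `F(x) + F(y) ≡ F(x+y) mod J^M_x ∩ J^M_y` on `P(1/2)`, then on `P(1/32)` one has
`F(x) ≡ L_x²·G(L_x) + T(x) mod J^M` with `G` a super polynomial `HP_d(1) → HP_d(s-2)`
and `T` locally linear. -/
theorem stmt14 (d D s : ℕ) (hd : 1 ≤ d) (hD : 1 ≤ D) (hds : s + 9 ≤ d)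
    (δ : ℝ) (hδ : 0 < δ) :
    ∃ p0 : ℕ, ∀ p : ℕ, p.Prime → p0 ≤ p →
    ∀ (M : (Fin d → ZMod p) → ZMod p) (A : Matrix (Fin d) (Fin d) (ZMod p))
      (u : Fin d → ZMod p) (w : ZMod p),
      IsQuadFormWith p d M A u w → A.det ≠ 0 →
    ∀ (v : Fin D → Fin d → ZMod p) (L : Fin D → ℝ), (∀ i, 0 < L i) →
      gapProper p d D v L →
      δ * (p : ℝ) ^ d < ((gap p d D v L 1).ncard : ℝ) →
    ∀ F : (Fin d → ZMod p) → MvPolynomial (Fin d) (ZMod p),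
      (∀ x ∈ gap p d D v L 1, (F x).IsHomogeneous s) →
      (∀ x ∈ gap p d D v L (1/2), ∀ y ∈ gap p d D v L (1/2),
        LinearIndependent (ZMod p) ![x, y] →
        F x + F y - F (x + y) ∈
          JM p d A (Submodule.span (ZMod p) {x} : Set (Fin d → ZMod p)) ⊓
            JM p d A (Submodule.span (ZMod p) {y} : Set (Fin d → ZMod p))) →
    ∃ (Cc : ℕ → MvPolynomial (Fin d) (ZMod p))
      (T : (Fin d → ZMod p) → MvPolynomial (Fin d) (ZMod p))
      (f₀ : MvPolynomial (Fin d) (ZMod p)) (fs : Fin D → MvPolynomial (Fin d) (ZMod p)),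
      (∀ i : ℕ, ((i : ℤ) ≤ (s : ℤ) - 2 → (Cc i).IsHomogeneous (s - 2 - i)) ∧
        ((s : ℤ) - 2 < (i : ℤ) → Cc i = 0)) ∧
      f₀.IsHomogeneous s ∧ (∀ i, (fs i).IsHomogeneous s) ∧
      (∀ ℓ : Fin D → ℤ,
        (∀ i, -((1/32) * L i) < (ℓ i : ℝ) ∧ (ℓ i : ℝ) < (1/32) * L i) →
        T (∑ i, ℓ i • v i) = f₀ + ∑ i, ℓ i • fs i) ∧
      (∀ x ∈ gap p d D v L (1/32), x ≠ 0 →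
        F x - (lx p d A x) ^ 2 *
            (∑ i ∈ Finset.range (s + 1), Cc i * (lx p d A x) ^ i) - T x ∈
          JM p d A ((⊥ : Submodule (ZMod p) (Fin d → ZMod p)) : Set (Fin d → ZMod p))) := by
  classical
  obtain ⟨N, hN⟩ := exists_nat_ge ((2:ℝ) ^ (10 * s + 20) * 64 ^ D / δ)
  refine ⟨N + s + 3, fun p hp hpN M A u w hM hdet v L hL hprop hcard F hF hFH => ?_⟩
  haveI : Fact p.Prime := ⟨hp⟩
  have hA := hM.1
  have hax := S14c.axQ (p := p) (d := d) (by omega) (by omega) A hA hdet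
  have hNp : (2:ℝ) ^ (10 * s + 20) * 64 ^ D / δ ≤ p := by
    refine hN.trans ?_
    exact_mod_cast (by omega : N ≤ p)
  obtain ⟨c, Fh, hc, hFh, hF0, hadd, hFe⟩ := Polynomial.S14.core (s := s)
    (P := gap p d D v L) (F := fun x => S14c.qmk p d A (F x)) hax
    (S14c.gap_add hL) S14c.gap_neg (S14c.gap_mono hL)
    (by
      intro i h1 h2 h
      rw [ZMod.natCast_eq_zero_iff] at h
      have := Nat.le_of_dvd (by omega) h
      omega)
    (fun B hB => S14c.gap_gen hL δ hδ (by omega) hNp hcard B hB)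
    (fun x hx => (S14c.Rt_nat A s _).2 ⟨F x, hF x hx, rfl⟩)
    (by
      intro x hx y hy hli
      have h := hFH x hx y hy hli
      have h1 := S14c.JM_dvd A hA x _ h.1
      have h2 := S14c.JM_dvd A hA y _ h.2
      rw [map_sub, map_add] at h1 h2
      exact ⟨h1, h2⟩)
  have hCc : ∀ i : ℕ, ∃ C : MvPolynomial (Fin d) (ZMod p), S14c.qmk p d A C = c i ∧
      ((i : ℤ) ≤ (s : ℤ) - 2 → C.IsHomogeneous (s - 2 - i)) ∧
        ((s : ℤ) - 2 < (i : ℤ) → C = 0) := by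
    intro i
    have h := hc i
    rcases lt_or_ge ((s : ℤ) - 2) i with hi | hi
    · refine ⟨0, ?_, fun h' => absurd h' (by omega), fun _ => rfl⟩
      rw [map_zero]
      exact (S14c.Rt_neg A _ (by omega) _ h).symm
    · rw [show (s : ℤ) - 2 - i = ((s - 2 - i : ℕ) : ℤ) by omega] at h
      obtain ⟨f, h1, h2⟩ := (S14c.Rt_nat A _ _).1 h
      exact ⟨f, h2, fun _ => h1, fun h' => absurd h' (by omega)⟩
  choose Cc hCc1 hCc2 using hCc
  have hfs : ∀ i : Fin D, ∃ f : MvPolynomial (Fin d) (ZMod p), f.IsHomogeneous s ∧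
      (v i ∈ gap p d D v L (1/32) → S14c.qmk p d A f = Fh (v i)) := by
    intro i
    by_cases h : v i ∈ gap p d D v L (1/32)
    · obtain ⟨f, h1, h2⟩ := (S14c.Rt_nat A _ _).1 (hFh _ h)
      exact ⟨f, h1, fun _ => h2⟩
    · exact ⟨0, isHomogeneous_zero _ _ _, fun h' => absurd h' h⟩
  choose fs hfs1 hfs2 using hfs
  let T : (Fin d → ZMod p) → MvPolynomial (Fin d) (ZMod p) := fun x =>
    if h : x ∈ gap p d D v L (1/32) then ∑ i, h.choose i • fs i else 0
  have hT : ∀ ℓ : Fin D → ℤ,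
      (∀ i, -((1/32) * L i) < (ℓ i : ℝ) ∧ (ℓ i : ℝ) < (1/32) * L i) →
      T (∑ i, ℓ i • v i) = ∑ i, ℓ i • fs i := by
    intro ℓ hℓ
    have hm : (∑ i, ℓ i • v i) ∈ gap p d D v L (1/32) := ⟨ℓ, hℓ, rfl⟩
    have hbox : ∀ k : Fin D → ℤ,
        (∀ i, -((1/32) * L i) < (k i : ℝ) ∧ (k i : ℝ) < (1/32) * L i) →
        ∀ i, -(L i) < (k i : ℝ) ∧ (k i : ℝ) < L i := by
      intro k hk i
      have h1 := hk i
      have h2 := hL i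
      constructor <;> linarith [h1.1, h1.2]
    have e : hm.choose = ℓ := hprop _ _ (hbox _ hm.choose_spec.1) (hbox _ hℓ) hm.choose_spec.2.symm
    simp only [T]
    rw [dif_pos hm, e]
  refine ⟨Cc, T, 0, fs, hCc2, isHomogeneous_zero _ _ _, hfs1, ?_, ?_⟩
  · intro ℓ hℓ
    rw [zero_add]
    exact hT ℓ hℓ
  · intro x hx hx0
    have hq : S14c.qmk p d A (T x) = Fh x := by
      obtain ⟨ℓ, hℓ, rfl⟩ := hx
      rw [hT ℓ hℓ, S14c.add_box hL (1/32) (by norm_num) Fh hF0 hadd _ ℓ hℓ rfl, map_sum]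
      refine Finset.sum_congr rfl fun i _ => ?_
      rw [map_zsmul]
      by_cases hi : ℓ i = 0
      · rw [hi, zero_smul, zero_smul]
      · rw [hfs2 i (S14c.gap_v hL _ (by norm_num) ℓ hℓ i hi)]
    have hz : S14c.qmk p d A (F x - (lx p d A x) ^ 2 *
            (∑ i ∈ Finset.range (s + 1), Cc i * (lx p d A x) ^ i) - T x) = 0 := by
      rw [map_sub, hq, hFe x hx0]
      simp only [map_sub, map_mul, map_pow, map_sum, hCc1, S14c.lam_apply, sub_self]
    rw [S14c.qmk_zero] at hz
    obtain ⟨a, ha⟩ := hz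
    rw [ha]
    exact Ideal.mul_mem_right _ _ (Ideal.subset_span (Or.inl rfl))
end
end

section
/- Let d ≥ 1 be an integer and s ∈ ℕ with d ≥ max{s+4, 13}, and let δ > 0. There exist a threshold p_0 and a real constant c > 0, both depending only on δ and d, such that for every prime p ≥ p_0 the following holds. Let M : 𝔽_p^d → 𝔽_p be a non-degenerate quadratic form, H ⊆ 𝔽_p^d, and ξ_1, ξ_2, ξ_3, ξ_4 : H → HP_d(s). If the M-energy of (ξ_1, ξ_2, ξ_3, ξ_4) is at least δ·p^{3d}, then the M-energy of (ξ_1, ξ_2, ξ_1, ξ_2) is at least c·p^{3d}. -/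
noncomputable section

open MvPolynomial

/-- The `M`-energy of `(ξ₁, ξ₂, ξ₃, ξ₄)` on `H`: the number of quadruples
`(h₁,h₂,h₃,h₄) ∈ H⁴` with `h₁ + h₂ = h₃ + h₄` and
`ξ₁(h₁) + ξ₂(h₂) - ξ₃(h₃) - ξ₄(h₄) ∈ J^M_{h₁,h₂,h₃,h₄}`. -/
def Menergy (p d : ℕ) (A : Matrix (Fin d) (Fin d) (ZMod p)) (H : Finset (Fin d → ZMod p))
    (ξ₁ ξ₂ ξ₃ ξ₄ : (Fin d → ZMod p) → MvPolynomial (Fin d) (ZMod p)) : ℕ :=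
  Set.ncard {q : ((Fin d → ZMod p) × (Fin d → ZMod p)) ×
      ((Fin d → ZMod p) × (Fin d → ZMod p)) |
    q.1.1 ∈ H ∧ q.1.2 ∈ H ∧ q.2.1 ∈ H ∧ q.2.2 ∈ H ∧ q.1.1 + q.1.2 = q.2.1 + q.2.2 ∧
    ξ₁ q.1.1 + ξ₂ q.1.2 - ξ₃ q.2.1 - ξ₄ q.2.2 ∈
      JM p d A
        (Submodule.span (ZMod p) {q.1.1, q.1.2, q.2.1, q.2.2} : Set (Fin d → ZMod p))}

open Matrix in
def linF (p d : ℕ) : (Fin d → ZMod p) →ₗ[ZMod p] MvPolynomial (Fin d) (ZMod p) :=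
  Fintype.linearCombination (ZMod p) (fun i => (X i : MvPolynomial (Fin d) (ZMod p)))

lemma linF_apply (p d : ℕ) (c : Fin d → ZMod p) : linF p d c = ∑ i, c i • X i := rfl

lemma linF_inj (p d : ℕ) (c : Fin d → ZMod p) (h : linF p d c = 0) : c = 0 := by
  ext j
  have := congrArg (fun f => MvPolynomial.coeff (Finsupp.single j 1) f) h
  simpa [linF_apply, MvPolynomial.coeff_sum, MvPolynomial.coeff_X, Finsupp.single_left_inj] using this

lemma linPoly_eq (p d : ℕ) (A : Matrix (Fin d) (Fin d) (ZMod p)) (h : Fin d → ZMod p) :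
    linPoly p d A h = linF p d (Matrix.vecMul h A) := by
  simp [linPoly, linF_apply, Matrix.vecMul, dotProduct, MvPolynomial.smul_eq_C_mul]

lemma JM_mono (p d : ℕ) (A : Matrix (Fin d) (Fin d) (ZMod p)) {V W : Set (Fin d → ZMod p)}
    (h : V ⊆ W) : JM p d A V ≤ JM p d A W :=
  Ideal.span_mono (Set.union_subset_union_right _ (Set.image_mono h))

def LM (p d : ℕ) (A : Matrix (Fin d) (Fin d) (ZMod p)) (W : Submodule (ZMod p) (Fin d → ZMod p)) :
    Ideal (MvPolynomial (Fin d) (ZMod p)) :=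
  Ideal.span (linPoly p d A '' W)

lemma JM_eq (p d : ℕ) (A : Matrix (Fin d) (Fin d) (ZMod p))
    (W : Submodule (ZMod p) (Fin d → ZMod p)) :
    JM p d A W = Ideal.span {quadPoly p d A} ⊔ LM p d A W := by
  rw [JM, Ideal.span_union]; rfl

lemma LM_sup (p d : ℕ) (A : Matrix (Fin d) (Fin d) (ZMod p))
    (W : Submodule (ZMod p) (Fin d → ZMod p)) (h : Fin d → ZMod p) :
    LM p d A (W ⊔ Submodule.span (ZMod p) {h}) = Ideal.span {linPoly p d A h} ⊔ LM p d A W := by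
  apply le_antisymm
  · refine Ideal.span_le.2 ?_
    rintro _ ⟨w, hw, rfl⟩
    obtain ⟨a, ha, b, hb, rfl⟩ := Submodule.mem_sup.1 hw
    obtain ⟨c, rfl⟩ := Submodule.mem_span_singleton.1 hb
    have : linPoly p d A (a + c • h) = C c * linPoly p d A h + linPoly p d A a := by
      simp only [linPoly_eq, Matrix.add_vecMul, Matrix.smul_vecMul, map_add, map_smul,
        MvPolynomial.smul_eq_C_mul]
      ring
    rw [this]
    refine Ideal.add_mem _ (Ideal.mem_sup_left ?_) (Ideal.mem_sup_right ?_)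
    · exact Ideal.mul_mem_left _ _ (Ideal.mem_span_singleton_self _)
    · exact Ideal.subset_span ⟨a, ha, rfl⟩
  · refine sup_le ?_ ?_
    · rw [Ideal.span_singleton_le_iff_mem]
      exact Ideal.subset_span ⟨h, Submodule.mem_sup_right (Submodule.mem_span_singleton_self h), rfl⟩
    · exact Ideal.span_mono (Set.image_mono (by exact_mod_cast le_sup_left))

lemma exists_E (p d : ℕ) [Fact p.Prime] (W : Submodule (ZMod p) (Fin d → ZMod p)) :
    ∃ E : (Fin d → ZMod p) →ₗ[ZMod p] (Fin d → ZMod p), LinearMap.ker E = W ∧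
      ∀ c, c - E c ∈ W := by
  obtain ⟨s, hs⟩ := LinearMap.exists_rightInverse_of_surjective W.mkQ
    (LinearMap.range_eq_top.2 W.mkQ_surjective)
  have hs' : ∀ x, W.mkQ (s x) = x := fun x => LinearMap.congr_fun hs x
  refine ⟨s ∘ₗ W.mkQ, ?_, ?_⟩
  · ext x
    rw [LinearMap.mem_ker, LinearMap.comp_apply]
    constructor
    · intro h
      have := hs' (W.mkQ x)
      rw [h, map_zero] at this
      simpa using this.symm
    · intro h
      have : W.mkQ x = 0 := by simpa using h
      rw [this, map_zero]
  · intro c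
    have : W.mkQ (c - s (W.mkQ c)) = 0 := by rw [map_sub, hs', sub_self]
    exact (Submodule.Quotient.mk_eq_zero W).1 this

/-- `LM` is the kernel of a linear substitution. -/
lemma LM_ker (p d : ℕ) [Fact p.Prime] (A : Matrix (Fin d) (Fin d) (ZMod p))
    (W : Submodule (ZMod p) (Fin d → ZMod p)) :
    ∃ E : (Fin d → ZMod p) →ₗ[ZMod p] (Fin d → ZMod p),
      LinearMap.ker E = W.map A.vecMulLinear ∧
      (∀ c, aeval (fun i => linF p d (E (Pi.single i 1))) (linF p d c) = linF p d (E c)) ∧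
      ∀ f, f ∈ LM p d A W ↔ aeval (fun i => linF p d (E (Pi.single i 1))) f = 0 := by
  obtain ⟨E, hE, hE2⟩ := exists_E p d (W.map A.vecMulLinear)
  have key : ∀ c, aeval (fun i => linF p d (E (Pi.single i 1))) (linF p d c) = linF p d (E c) := by
    intro c
    conv_rhs => rw [pi_eq_sum_univ' c]
    rw [linF_apply]
    simp only [map_sum, map_smul, aeval_X]
  refine ⟨E, hE, key, ?_⟩
  have h1 : ∀ f ∈ LM p d A W, aeval (fun i => linF p d (E (Pi.single i 1))) f = 0 := by
    intro f hf
    have : LM p d A W ≤ RingHom.ker (aeval (R := ZMod p) (fun i => linF p d (E (Pi.single i 1)))) := by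
      refine Ideal.span_le.2 ?_
      rintro _ ⟨w, hw, rfl⟩
      have : E (Matrix.vecMul w A) = 0 := by
        rw [← LinearMap.mem_ker, hE]; exact ⟨w, hw, rfl⟩
      simp only [SetLike.mem_coe, RingHom.mem_ker]
      rw [linPoly_eq, key, this, map_zero]
    exact this hf
  have h2 : ∀ f, f - aeval (fun i => linF p d (E (Pi.single i 1))) f ∈ LM p d A W := by
    intro f
    induction f using MvPolynomial.induction_on with
    | C a => simp
    | add f g hf hg =>
      rw [map_add, add_sub_add_comm]; exact Ideal.add_mem _ hf hg
    | mul_X f i hf =>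
      have hX : (X i : MvPolynomial (Fin d) (ZMod p)) = linF p d (Pi.single i 1) := by
        simp [linF_apply, Pi.single_apply]
      have hx : (X i : MvPolynomial (Fin d) (ZMod p)) - linF p d (E (Pi.single i 1)) ∈ LM p d A W := by
        obtain ⟨w, hw, hw2⟩ := hE2 (Pi.single i 1)
        have hw2 : Matrix.vecMul w A = _ := hw2
        rw [hX, ← map_sub, ← hw2, ← linPoly_eq]
        exact Ideal.subset_span ⟨w, hw, rfl⟩
      rw [map_mul, aeval_X]
      have := Ideal.add_mem _ (Ideal.mul_mem_right (X i) _ hf)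
        (Ideal.mul_mem_left _ (aeval (fun i => linF p d (E (Pi.single i 1))) f) hx)
      convert this using 1
      ring
  intro f
  refine ⟨h1 f, fun h => ?_⟩
  have := h2 f
  rwa [h, sub_zero] at this

lemma LM_prime (p d : ℕ) [Fact p.Prime] (A : Matrix (Fin d) (Fin d) (ZMod p))
    (W : Submodule (ZMod p) (Fin d → ZMod p)) (f g : MvPolynomial (Fin d) (ZMod p))
    (h : f * g ∈ LM p d A W) : f ∈ LM p d A W ∨ g ∈ LM p d A W := by
  obtain ⟨E, -, -, hE⟩ := LM_ker p d A W
  rw [hE, map_mul, mul_eq_zero] at h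
  rwa [hE, hE]

lemma mem_of_linPoly_mem (p d : ℕ) [Fact p.Prime] (A : Matrix (Fin d) (Fin d) (ZMod p))
    (hA : A.det ≠ 0)
    (W : Submodule (ZMod p) (Fin d → ZMod p)) (h : Fin d → ZMod p)
    (hh : linPoly p d A h ∈ LM p d A W) : h ∈ W := by
  obtain ⟨E, h1, h2, hE⟩ := LM_ker p d A W
  rw [hE, linPoly_eq, h2] at hh
  have := linF_inj _ _ _ hh
  rw [← LinearMap.mem_ker, h1] at this
  obtain ⟨w, hw, hw2⟩ := this
  have hw2 : Matrix.vecMul w A = Matrix.vecMul h A := hw2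
  have := Matrix.vecMul_injective_of_isUnit ((Matrix.isUnit_iff_isUnit_det A).2 hA.isUnit) hw2
  rwa [← this]

open Matrix in
lemma quad_notMem (p d : ℕ) [Fact p.Prime] (hp : p ≠ 2) (A : Matrix (Fin d) (Fin d) (ZMod p))
    (hA : A.det ≠ 0) (hs : A.IsSymm)
    (W : Submodule (ZMod p) (Fin d → ZMod p)) (hW : 2 * Module.finrank (ZMod p) W < d) :
    quadPoly p d A ∉ LM p d A W := by
  intro hq
  obtain ⟨E, h1, h2, hE⟩ := LM_ker p d A W
  rw [hE] at hq
  set B := LinearMap.toMatrix' E with hB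
  have hBE : ∀ i j, B j i = E (Pi.single i 1) j := fun i j => by
    simp [hB, LinearMap.toMatrix'_apply]
  have hev : ∀ n : Fin d → ZMod p, (n ᵥ* (B * A * Bᵀ)) ⬝ᵥ n = 0 := by
    intro n
    have h3 := congrArg (MvPolynomial.eval n) hq
    have h4 : ∀ i, MvPolynomial.eval n (linF p d (E (Pi.single i 1))) = (n ᵥ* B) i := by
      intro i
      simp [linF_apply, Matrix.vecMul, dotProduct, hBE, MvPolynomial.smul_eval, mul_comm]
    simp only [quadPoly, map_sum, map_mul, aeval_X, aeval_C, map_zero, h4,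
      MvPolynomial.algebraMap_eq, eval_C] at h3
    rw [← Matrix.vecMul_vecMul, ← Matrix.dotProduct_mulVec, ← Matrix.vecMul_vecMul,
      Matrix.mulVec_transpose]
    rw [← h3]
    generalize n ᵥ* B = m
    simp only [dotProduct, Matrix.vecMul, Finset.sum_mul]
    rw [Finset.sum_comm]
    refine Finset.sum_congr rfl fun i _ => Finset.sum_congr rfl fun j _ => by ring
  set S := B * A * Bᵀ with hS
  have hSs : Sᵀ = S := by
    rw [hS, Matrix.transpose_mul, Matrix.transpose_mul, Matrix.transpose_transpose, hs.eq,
      Matrix.mul_assoc]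
  have h2ne : (2 : ZMod p) ≠ 0 := by
    intro h
    have : ((2 : ℕ) : ZMod p) = 0 := by exact_mod_cast h
    rw [ZMod.natCast_eq_zero_iff] at this
    exact hp ((Nat.prime_dvd_prime_iff_eq (Fact.out) Nat.prime_two).1 this)
  have hS0 : S = 0 := by
    ext i j
    have e1 := hev (Pi.single i 1)
    have e2 := hev (Pi.single j 1)
    have e3 := hev (Pi.single i 1 + Pi.single j 1)
    have e4 : S i j = S j i := by conv_lhs => rw [← hSs, Matrix.transpose_apply]
    simp [Matrix.add_vecMul] at e1 e2 e3
    have : 2 * S i j = 0 := by linear_combination e3 - e1 - e2 + e4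
    simpa [h2ne] using this
  have hr := Matrix.rank_add_rank_le_card_of_mul_eq_zero (A := B) (B := A * Bᵀ)
    (by rw [← Matrix.mul_assoc, ← hS, hS0])
  rw [Matrix.rank_mul_eq_right_of_isUnit_det _ _ hA.isUnit, Matrix.rank_transpose] at hr
  have hrk : B.rank = Module.finrank (ZMod p) (LinearMap.range E) := by
    rw [Matrix.rank, hB, ← Matrix.toLin'_apply', Matrix.toLin'_toMatrix']
  have hrn := LinearMap.finrank_range_add_finrank_ker E
  have hk : Module.finrank (ZMod p) (LinearMap.ker E) ≤ Module.finrank (ZMod p) W := by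
    rw [h1]; exact Submodule.finrank_map_le _ _
  simp at hr hrn
  omega

lemma cancel_lin (p d : ℕ) [Fact p.Prime] (hp : p ≠ 2) (A : Matrix (Fin d) (Fin d) (ZMod p))
    (hA : A.det ≠ 0) (hs : A.IsSymm)
    (W : Submodule (ZMod p) (Fin d → ZMod p)) (hW : 2 * (Module.finrank (ZMod p) W + 1) < d)
    (h : Fin d → ZMod p) (hh : h ∉ W) (g : MvPolynomial (Fin d) (ZMod p))
    (hg : linPoly p d A h * g ∈ JM p d A W) : g ∈ JM p d A W := by
  have hW2 : 2 * Module.finrank (ZMod p) (W ⊔ Submodule.span (ZMod p) {h} :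
      Submodule (ZMod p) (Fin d → ZMod p)) < d := by
    have h1 := Submodule.finrank_add_le_finrank_add_finrank W (Submodule.span (ZMod p) {h})
    have h2 := finrank_span_le_card (R := ZMod p) ({h} : Set (Fin d → ZMod p))
    simp at h2
    omega
  rw [JM_eq, Ideal.mem_span_singleton_sup] at hg
  obtain ⟨c, w, hw, hc⟩ := hg
  have h1 : c * quadPoly p d A ∈ LM p d A (W ⊔ Submodule.span (ZMod p) {h}) := by
    rw [LM_sup, Ideal.mem_span_singleton_sup]
    exact ⟨g, -w, neg_mem hw, by linear_combination -hc⟩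
  have h2 := (LM_prime _ _ _ _ _ _ h1).resolve_right (quad_notMem p d hp A hA hs _ hW2)
  rw [LM_sup, Ideal.mem_span_singleton_sup] at h2
  obtain ⟨c', w', hw', hc'⟩ := h2
  have h3 : linPoly p d A h * (g - quadPoly p d A * c') ∈ LM p d A W := by
    have : linPoly p d A h * (g - quadPoly p d A * c') = quadPoly p d A * w' + w := by
      linear_combination -hc - quadPoly p d A * hc'
    rw [this]
    exact Ideal.add_mem _ (Ideal.mul_mem_left _ _ hw') hw
  have h4 := (LM_prime _ _ _ _ _ _ h3).resolve_left
    (fun hx => hh (mem_of_linPoly_mem p d A hA W h hx))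
  rw [JM_eq, Ideal.mem_span_singleton_sup]
  exact ⟨c', _, h4, by ring⟩

lemma linPoly_hom (p d : ℕ) (A : Matrix (Fin d) (Fin d) (ZMod p)) (h : Fin d → ZMod p) :
    (linPoly p d A h).IsHomogeneous 1 := by
  refine MvPolynomial.IsHomogeneous.sum _ _ _ fun i _ => ?_
  exact isHomogeneous_C_mul_X _ i

lemma quadPoly_hom (p d : ℕ) (A : Matrix (Fin d) (Fin d) (ZMod p)) :
    (quadPoly p d A).IsHomogeneous 2 := by
  refine MvPolynomial.IsHomogeneous.sum _ _ _ fun i _ => ?_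
  refine MvPolynomial.IsHomogeneous.sum _ _ _ fun j _ => ?_
  exact ((isHomogeneous_X _ i).mul (isHomogeneous_X _ j)).C_mul _

lemma JM_comp (p d : ℕ) (A : Matrix (Fin d) (Fin d) (ZMod p)) (W : Set (Fin d → ZMod p))
    (f : MvPolynomial (Fin d) (ZMod p)) (hf : f ∈ JM p d A W) (n : ℕ) :
    homogeneousComponent n f ∈ JM p d A W := by
  letI := MvPolynomial.gradedAlgebra (σ := Fin d) (R := ZMod p)
  apply MvPolynomial.homogeneousComponent_mem_of_mem _ hf
  apply Ideal.homogeneous_span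
  rintro x (rfl | ⟨w, hw, rfl⟩)
  · exact ⟨2, quadPoly_hom p d A⟩
  · exact ⟨1, linPoly_hom p d A w⟩

lemma comp_mul (p d : ℕ) (l g : MvPolynomial (Fin d) (ZMod p)) (hl : l.IsHomogeneous 1) (n : ℕ) :
    homogeneousComponent (n + 1) (l * g) = l * homogeneousComponent n g := by
  letI := MvPolynomial.gradedAlgebra (σ := Fin d) (R := ZMod p)
  have := DirectSum.coe_decompose_mul_add_of_left_mem
    (homogeneousSubmodule (Fin d) (ZMod p)) (i := 1) (j := n) (a := l) (b := g) hl
  rw [add_comm, ← decomposition.decompose'_apply, ← decomposition.decompose'_apply]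
  exact this

lemma JM_const (p d : ℕ) (A : Matrix (Fin d) (Fin d) (ZMod p)) (W : Set (Fin d → ZMod p))
    (f : MvPolynomial (Fin d) (ZMod p)) (hf : f ∈ JM p d A W) (h0 : f.IsHomogeneous 0) : f = 0 := by
  have h1 : JM p d A W ≤ RingHom.ker (MvPolynomial.constantCoeff (R := ZMod p) (σ := Fin d)) := by
    refine Ideal.span_le.2 ?_
    rintro x (rfl | ⟨w, hw, rfl⟩)
    · simp [quadPoly]
    · simp [linPoly]
  have h2 := h1 hf
  rw [RingHom.mem_ker] at h2
  have h3 := homogeneousComponent_eq_self h0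
  rw [homogeneousComponent_zero] at h3
  rw [← h3]
  rw [constantCoeff_eq] at h2
  rw [h2, map_zero]

lemma card_sup_le (p d : ℕ) [Fact p.Prime] (V : Submodule (ZMod p) (Fin d → ZMod p))
    (hV : Module.finrank (ZMod p) V ≤ 3) (h : Fin d → ZMod p) (S : Finset (Fin d → ZMod p))
    (hS : ∀ x ∈ S, x ∈ V ⊔ Submodule.span (ZMod p) {h}) : S.card ≤ p ^ 4 := by
  classical
  have h1 := Submodule.finrank_add_le_finrank_add_finrank V (Submodule.span (ZMod p) {h})
  have h2 := finrank_span_le_card (R := ZMod p) ({h} : Set (Fin d → ZMod p))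
  simp at h2
  have h3 := Module.card_eq_pow_finrank (K := ZMod p)
    (V := (V ⊔ Submodule.span (ZMod p) {h} : Submodule (ZMod p) (Fin d → ZMod p)))
  rw [ZMod.card] at h3
  calc S.card = Fintype.card S := by simp
    _ ≤ Fintype.card (V ⊔ Submodule.span (ZMod p) {h} : Submodule (ZMod p) (Fin d → ZMod p)) :=
      Fintype.card_le_of_injective (fun x => ⟨x.1, hS _ x.2⟩)
        (fun x y hxy => Subtype.ext (by simpa using hxy))
    _ ≤ p ^ 4 := by
      rw [h3]
      exact Nat.pow_le_pow_right (Fact.out : p.Prime).pos (by omega)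

lemma main_alg (p d : ℕ) [Fact p.Prime] (hp : p ≠ 2) (A : Matrix (Fin d) (Fin d) (ZMod p))
    (hA : A.det ≠ 0) (hs : A.IsSymm) (hd : 13 ≤ d)
    (V : Submodule (ZMod p) (Fin d → ZMod p)) (hV : Module.finrank (ZMod p) V ≤ 3) (s : ℕ) :
    ∀ (f : MvPolynomial (Fin d) (ZMod p)), f.IsHomogeneous s →
    ∀ S : Finset (Fin d → ZMod p), s * p ^ 4 < S.card →
    (∀ h ∈ S, f ∈ JM p d A (V ⊔ Submodule.span (ZMod p) {h} :
      Submodule (ZMod p) (Fin d → ZMod p))) → f ∈ JM p d A V := by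
  classical
  induction s with
  | zero =>
    intro f hf S hS h
    obtain ⟨x, hx⟩ := Finset.card_pos.1 (by omega : 0 < S.card)
    rw [JM_const _ _ _ _ f (h x hx) hf]
    exact Ideal.zero_mem _
  | succ s ih =>
    intro f hf S hS h
    obtain ⟨x, hx⟩ := Finset.card_pos.1 (by omega : 0 < S.card)
    have hfx := h x hx
    by_cases hxV : x ∈ V
    · rwa [sup_eq_left.2 ((Submodule.span_singleton_le_iff_mem _ _).2 hxV)] at hfx
    rw [JM_eq, LM_sup, ← sup_assoc, sup_comm (Ideal.span _) (Ideal.span _), sup_assoc, ← JM_eq,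
      Ideal.mem_span_singleton_sup] at hfx
    obtain ⟨g0, j0, hj0, hfg⟩ := hfx
    set g := homogeneousComponent s g0 with hg
    set j := homogeneousComponent (s + 1) j0 with hj
    have hjm : j ∈ JM p d A V := JM_comp _ _ _ _ _ hj0 _
    have hfe : f = linPoly p d A x * g + j := by
      rw [hg, hj, ← comp_mul _ _ _ _ (linPoly_hom p d A x), ← map_add, mul_comm, hfg,
        homogeneousComponent_eq_self hf]
    have hgm : g ∈ JM p d A V := by
      refine ih g (homogeneousComponent_isHomogeneous _ _)
        (S.filter (fun y => y ∉ V ⊔ Submodule.span (ZMod p) {x})) ?_ ?_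
      · have h1 := card_sup_le p d V hV x
          (S.filter (fun y => y ∈ V ⊔ Submodule.span (ZMod p) {x}))
          (fun y hy => (Finset.mem_filter.1 hy).2)
        have h2 := Finset.card_filter_add_card_filter_not (s := S)
          (fun y => y ∈ V ⊔ Submodule.span (ZMod p) {x})
        rw [add_mul] at hS
        omega
      · intro y hy
        obtain ⟨hyS, hyx⟩ := Finset.mem_filter.1 hy
        apply cancel_lin p d hp A hA hs _ _ x
        · intro hxy
          apply hyx
          obtain ⟨a, ha, b, hb, hab⟩ := Submodule.mem_sup.1 hxy
          obtain ⟨c, rfl⟩ := Submodule.mem_span_singleton.1 hb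
          have hc : c ≠ 0 := by
            rintro rfl
            apply hxV
            simp at hab
            rwa [← hab]
          refine Submodule.mem_sup.2 ⟨-(c⁻¹ • a), neg_mem (V.smul_mem _ ha), c⁻¹ • x,
            Submodule.smul_mem _ _ (Submodule.mem_span_singleton_self x), ?_⟩
          rw [← hab, smul_add, smul_smul, inv_mul_cancel₀ hc, one_smul]
          abel
        · have : linPoly p d A x * g = f - j := by rw [hfe]; ring
          rw [this]
          exact Ideal.sub_mem _ (h y hyS) (JM_mono _ _ _ (by exact_mod_cast le_sup_left) hjm)
        · have h1 := Submodule.finrank_add_le_finrank_add_finrank V (Submodule.span (ZMod p) {y})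
          have h2 := finrank_span_le_card (R := ZMod p) ({y} : Set (Fin d → ZMod p))
          simp at h2
          omega
    rw [hfe]
    exact Ideal.add_mem _ (Ideal.mul_mem_left _ _ hgm) hjm

open Classical in
lemma comb {V : Type*} [Fintype V] [Nonempty V] (P G : V → V → V → Prop) (δ K : ℝ) (hδ : 0 < δ)
    (hP : δ * (Fintype.card V : ℝ) ^ 3 ≤
      ((Finset.univ.filter (fun x : V × V × V => P x.1 x.2.1 x.2.2)).card : ℝ))
    (hK : K ≤ δ ^ 2 / 2 * Fintype.card V) (hK0 : 0 ≤ K)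
    (hG : ∀ t a a', ¬ G t a a' →
      ((Finset.univ.filter (fun b => P t a b ∧ P t a' b)).card : ℝ) ≤ K) :
    δ ^ 2 / 2 * (Fintype.card V : ℝ) ^ 3 ≤
      ((Finset.univ.filter (fun x : V × V × V => G x.1 x.2.1 x.2.2)).card : ℝ) := by
  set N : ℝ := (Fintype.card V : ℝ) with hN
  have hNpos : 0 < N := by rw [hN]; exact_mod_cast Fintype.card_pos
  set g : ℝ := ((Finset.univ.filter (fun x : V × V × V => G x.1 x.2.1 x.2.2)).card : ℝ) with hg
  have e1 : ((Finset.univ.filter (fun x : V × V × V => P x.1 x.2.1 x.2.2)).card : ℝ) =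
      ∑ x : V × V, ∑ a : V, (if P x.1 a x.2 then (1 : ℝ) else 0) := by
    rw [Finset.card_filter]
    push_cast
    simp only [Fintype.sum_prod_type]
    exact Finset.sum_congr rfl fun t _ => Finset.sum_comm
  have e2 : g = ∑ t : V, ∑ a : V, ∑ a' : V, (if G t a a' then (1 : ℝ) else 0) := by
    rw [hg, Finset.card_filter]
    push_cast
    simp only [Fintype.sum_prod_type]
  have cs := sq_sum_le_card_mul_sum_sq (s := (Finset.univ : Finset (V × V)))
    (f := fun x => ∑ a : V, (if P x.1 a x.2 then (1 : ℝ) else 0))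
  rw [← e1] at cs
  have e3 : ∑ x : V × V, (∑ a : V, (if P x.1 a x.2 then (1 : ℝ) else 0)) ^ 2 =
      ∑ t : V, ∑ a : V, ∑ a' : V,
        ((Finset.univ.filter (fun b => P t a b ∧ P t a' b)).card : ℝ) := by
    rw [Fintype.sum_prod_type]
    refine Finset.sum_congr rfl fun t _ => ?_
    simp only [sq, Finset.sum_mul_sum]
    rw [Finset.sum_comm]
    refine Finset.sum_congr rfl fun a _ => ?_
    rw [Finset.sum_comm]
    refine Finset.sum_congr rfl fun a' _ => ?_
    rw [Finset.card_filter]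
    push_cast
    refine Finset.sum_congr rfl fun b _ => ?_
    by_cases h1 : P t a b <;> by_cases h2 : P t a' b <;> simp [h1, h2]
  have e4 : ∑ t : V, ∑ a : V, ∑ a' : V,
        ((Finset.univ.filter (fun b => P t a b ∧ P t a' b)).card : ℝ) ≤ g * N + N ^ 3 * K := by
    have : g * N + N ^ 3 * K = ∑ t : V, ∑ a : V, ∑ a' : V,
        ((if G t a a' then (1 : ℝ) else 0) * N + K) := by
      simp only [Finset.sum_add_distrib, ← Finset.sum_mul, ← e2]
      simp [← hN]
      ring
    rw [this]
    refine Finset.sum_le_sum fun t _ => Finset.sum_le_sum fun a _ => Finset.sum_le_sum fun a' _ => ?_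
    by_cases h : G t a a'
    · have : ((Finset.univ.filter (fun b => P t a b ∧ P t a' b)).card : ℝ) ≤ N := by
        rw [hN]; exact_mod_cast Finset.card_le_univ _
      simp [h]; linarith
    · simpa [h] using hG t a a' h
  rw [e3] at cs
  have hc : ((Finset.univ : Finset (V × V)).card : ℝ) = N ^ 2 := by
    simp [hN, sq]
  rw [hc] at cs
  have h5 : (δ * N ^ 3) ^ 2 ≤ N ^ 2 * (g * N + N ^ 3 * K) :=
    (pow_le_pow_left₀ (by positivity) hP 2).trans
      (cs.trans (mul_le_mul_of_nonneg_left e4 (by positivity)))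
  have h6 : N ^ 3 * K ≤ N ^ 3 * (δ ^ 2 / 2 * N) := mul_le_mul_of_nonneg_left hK (by positivity)
  have h7 : N ^ 2 * (g * N + N ^ 3 * K) ≤ N ^ 2 * (g * N + N ^ 3 * (δ ^ 2 / 2 * N)) :=
    mul_le_mul_of_nonneg_left (by linarith) (by positivity)
  have h8 : N ^ 3 * (δ ^ 2 / 2 * N ^ 3) ≤ N ^ 3 * g := by nlinarith
  exact le_of_mul_le_mul_left h8 (by positivity)

/-- The energy predicate in the parameters `(t, a, b)`. -/
def EP (p d : ℕ) (A : Matrix (Fin d) (Fin d) (ZMod p)) (H : Finset (Fin d → ZMod p))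
    (ξ₁ ξ₂ ξ₃ ξ₄ : (Fin d → ZMod p) → MvPolynomial (Fin d) (ZMod p))
    (t a b : Fin d → ZMod p) : Prop :=
  a ∈ H ∧ t - a ∈ H ∧ b ∈ H ∧ t - b ∈ H ∧
    ξ₁ a + ξ₂ (t - a) - ξ₃ b - ξ₄ (t - b) ∈
      JM p d A (Submodule.span (ZMod p) {a, t - a, b, t - b} : Set (Fin d → ZMod p))

open Classical in
lemma energy_card (p d : ℕ) [Fact p.Prime] (A : Matrix (Fin d) (Fin d) (ZMod p))
    (H : Finset (Fin d → ZMod p))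
    (ξ₁ ξ₂ ξ₃ ξ₄ : (Fin d → ZMod p) → MvPolynomial (Fin d) (ZMod p)) :
    Menergy p d A H ξ₁ ξ₂ ξ₃ ξ₄ = (Finset.univ.filter
      (fun x : (Fin d → ZMod p) × (Fin d → ZMod p) × (Fin d → ZMod p) =>
        EP p d A H ξ₁ ξ₂ ξ₃ ξ₄ x.1 x.2.1 x.2.2)).card := by
  rw [← Set.ncard_coe_finset, Menergy]
  symm
  have hinj : Function.Injective (fun x : (Fin d → ZMod p) × (Fin d → ZMod p) × (Fin d → ZMod p) =>
      ((x.2.1, x.1 - x.2.1), (x.2.2, x.1 - x.2.2))) := by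
    rintro ⟨t, a, b⟩ ⟨t', a', b'⟩ h
    simp only [Prod.mk.injEq] at h
    obtain ⟨⟨rfl, h1⟩, rfl, -⟩ := h
    simpa using h1
  rw [← Set.ncard_image_of_injective _ hinj]
  congr 1
  ext ⟨⟨a, a'⟩, b, b'⟩
  simp only [Set.mem_image, Finset.mem_coe, Finset.mem_filter, Finset.mem_univ, true_and,
    Set.mem_ofPred_eq, Prod.mk.injEq, Prod.exists]
  constructor
  · rintro ⟨t, x, y, ⟨h1, h2, h3, h4, h5⟩, ⟨rfl, rfl⟩, rfl, rfl⟩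
    exact ⟨h1, h2, h3, h4, by abel, h5⟩
  · rintro ⟨h1, h2, h3, h4, h5, h6⟩
    have e1 : a + a' - a = a' := by abel
    have e2 : a + a' - b = b' := by rw [h5]; abel
    refine ⟨a + a', a, b, ?_, ⟨rfl, e1⟩, rfl, e2⟩
    rw [EP, e1, e2]
    exact ⟨h1, h2, h3, h4, h6⟩

lemma step (p d s : ℕ) [Fact p.Prime] (hp : p ≠ 2) (A : Matrix (Fin d) (Fin d) (ZMod p))
    (hA : A.det ≠ 0) (hs : A.IsSymm) (hd : 13 ≤ d) (H : Finset (Fin d → ZMod p))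
    (ξ₁ ξ₂ ξ₃ ξ₄ : (Fin d → ZMod p) → MvPolynomial (Fin d) (ZMod p))
    (hx1 : ∀ h ∈ H, (ξ₁ h).IsHomogeneous s) (hx2 : ∀ h ∈ H, (ξ₂ h).IsHomogeneous s)
    (t a a' : Fin d → ZMod p) (S : Finset (Fin d → ZMod p)) (hS : s * p ^ 4 < S.card)
    (hb : ∀ b ∈ S, EP p d A H ξ₁ ξ₂ ξ₃ ξ₄ t a b ∧ EP p d A H ξ₁ ξ₂ ξ₃ ξ₄ t a' b) :
    EP p d A H ξ₁ ξ₂ ξ₁ ξ₂ t a a' := by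
  classical
  obtain ⟨b0, hb0⟩ := Finset.card_pos.1 (by omega : 0 < S.card)
  obtain ⟨⟨ha, hta, -⟩, ⟨ha', hta', -⟩⟩ := hb b0 hb0
  refine ⟨ha, hta, ha', hta', ?_⟩
  set V : Submodule (ZMod p) (Fin d → ZMod p) := Submodule.span (ZMod p) {t, a, a'} with hV
  have htV : t ∈ V := Submodule.subset_span (by simp)
  have haV : a ∈ V := Submodule.subset_span (by simp)
  have ha'V : a' ∈ V := Submodule.subset_span (by simp)
  have hVd : Module.finrank (ZMod p) V ≤ 3 := by
    have h1 := finrank_span_finset_le_card (R := ZMod p) ({t, a, a'} : Finset (Fin d → ZMod p))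
    have h2 := Finset.card_le_three (a := t) (b := a) (c := a')
    have h3 := h1.trans h2
    rw [Set.finrank, Finset.coe_insert, Finset.coe_insert, Finset.coe_singleton] at h3
    exact h3
  have hmem : ξ₁ a + ξ₂ (t - a) - ξ₁ a' - ξ₂ (t - a') ∈ JM p d A V := by
    refine main_alg p d hp A hA hs hd V hVd s _ ?_ S hS ?_
    · exact (((hx1 _ ha).add (hx2 _ hta)).sub (hx1 _ ha')).sub (hx2 _ hta')
    · intro b hbS
      obtain ⟨⟨-, -, -, -, h1⟩, ⟨-, -, -, -, h2⟩⟩ := hb b hbS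
      have hle : V ≤ V ⊔ Submodule.span (ZMod p) {b} := le_sup_left
      have hbm : b ∈ V ⊔ Submodule.span (ZMod p) {b} :=
        Submodule.mem_sup_right (Submodule.mem_span_singleton_self b)
      have gen : ∀ x ∈ V, Submodule.span (ZMod p) {x, t - x, b, t - b} ≤
          V ⊔ Submodule.span (ZMod p) {b} := by
        intro x hx
        rw [Submodule.span_le]
        rintro y (rfl | rfl | rfl | rfl)
        · exact hle hx
        · exact hle (V.sub_mem htV hx)
        · exact hbm
        · exact Submodule.sub_mem _ (hle htV) hbm
      have h1' := JM_mono p d A (SetLike.coe_subset_coe.2 (gen a haV)) h1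
      have h2' := JM_mono p d A (SetLike.coe_subset_coe.2 (gen a' ha'V)) h2
      have := Ideal.sub_mem _ h1' h2'
      convert this using 1
      ring
  refine JM_mono p d A (SetLike.coe_subset_coe.2 ?_) hmem
  rw [hV, Submodule.span_le]
  have i1 : a ∈ Submodule.span (ZMod p) {a, t - a, a', t - a'} := Submodule.subset_span (by simp)
  have i2 : t - a ∈ Submodule.span (ZMod p) {a, t - a, a', t - a'} :=
    Submodule.subset_span (by simp)
  have i3 : a' ∈ Submodule.span (ZMod p) {a, t - a, a', t - a'} := Submodule.subset_span (by simp)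
  rintro y (rfl | rfl | rfl)
  · simpa using Submodule.add_mem _ i2 i1
  · exact i1
  · exact i3

/-- **Cauchy–Schwarz inequality for `M`-energies.** -/
theorem stmt15 (d s : ℕ) (hd : 1 ≤ d) (hds : max (s + 4) 13 ≤ d) (δ : ℝ) (hδ : 0 < δ) :
    ∃ (p0 : ℕ) (c : ℝ), 0 < c ∧
    ∀ p : ℕ, p.Prime → p0 ≤ p →
    ∀ (M : (Fin d → ZMod p) → ZMod p) (A : Matrix (Fin d) (Fin d) (ZMod p))
      (u : Fin d → ZMod p) (v : ZMod p),
      IsQuadFormWith p d M A u v → A.det ≠ 0 →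
    ∀ H : Finset (Fin d → ZMod p),
    ∀ ξ₁ ξ₂ ξ₃ ξ₄ : (Fin d → ZMod p) → MvPolynomial (Fin d) (ZMod p),
      (∀ h ∈ H, (ξ₁ h).IsHomogeneous s) → (∀ h ∈ H, (ξ₂ h).IsHomogeneous s) →
      (∀ h ∈ H, (ξ₃ h).IsHomogeneous s) → (∀ h ∈ H, (ξ₄ h).IsHomogeneous s) →
      δ * (p : ℝ) ^ (3 * d) ≤ (Menergy p d A H ξ₁ ξ₂ ξ₃ ξ₄ : ℝ) →
      c * (p : ℝ) ^ (3 * d) ≤ (Menergy p d A H ξ₁ ξ₂ ξ₁ ξ₂ : ℝ) := by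

  classical
  refine ⟨max 3 ⌈2 * s / δ ^ 2⌉₊, δ ^ 2 / 2, by positivity, ?_⟩
  intro p hp hp0 M A u v hM hA H ξ₁ ξ₂ ξ₃ ξ₄ h1 h2 h3 h4 hE
  haveI : Fact p.Prime := ⟨hp⟩
  have hp3 : 3 ≤ p := (le_max_left _ _).trans hp0
  have hps : 2 * s / δ ^ 2 ≤ (p : ℝ) :=
    (Nat.le_ceil _).trans (by exact_mod_cast (le_max_right _ _).trans hp0)
  have hd13 : 13 ≤ d := (le_max_right _ _).trans hds
  have hcard : (Fintype.card (Fin d → ZMod p) : ℝ) = (p : ℝ) ^ d := by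
    simp [ZMod.card]
  have hpow : (p : ℝ) ^ (3 * d) = (Fintype.card (Fin d → ZMod p) : ℝ) ^ 3 := by
    rw [hcard, ← pow_mul, mul_comm]
  rw [hpow, energy_card] at hE
  rw [hpow, energy_card]
  have hp1 : (1 : ℝ) ≤ p := by exact_mod_cast hp.one_le
  refine comb (EP p d A H ξ₁ ξ₂ ξ₃ ξ₄) (EP p d A H ξ₁ ξ₂ ξ₁ ξ₂) δ ((s * p ^ 4 : ℕ) : ℝ) hδ hE ?_
    (by positivity) ?_
  · rw [hcard]
    have e1 : (s : ℝ) ≤ δ ^ 2 / 2 * p := by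
      rw [div_le_iff₀ (by positivity)] at hps
      linarith
    have e2 : (p : ℝ) ^ 5 ≤ (p : ℝ) ^ d := pow_le_pow_right₀ hp1 (by omega)
    push_cast
    calc (s : ℝ) * (p : ℝ) ^ 4 ≤ (δ ^ 2 / 2 * p) * (p : ℝ) ^ 4 :=
          mul_le_mul_of_nonneg_right e1 (by positivity)
      _ = δ ^ 2 / 2 * (p : ℝ) ^ 5 := by ring
      _ ≤ _ := mul_le_mul_of_nonneg_left e2 (by positivity)
  · intro t a a' hn
    by_contra hlt
    push Not at hlt
    apply hn
    refine step p d s (by omega) A hA hM.1 hd13 H ξ₁ ξ₂ ξ₃ ξ₄ h1 h2 t a a' _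
      (by exact_mod_cast hlt) ?_
    intro b hb
    exact (Finset.mem_filter.1 hb).2
end
end
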